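/- arXiv:2301.05613 — 9 statements merged into one kernel-verified Lean document; each statement's English description precedes it below -/
import Mathlib

section
/- Let K₁ and K₂ be fields of characteristic 2. If the stable linear groups GL(K₁) and GL(K₂) are elementarily equivalent as structures in the first-order language of groups, then the fields K₁ and K₂ are elementarily equivalent as structures in the first-order language of rings. -/
/-- The functions of the first-order language of groups:
multiplication (binary), inverse (unary) and identity (constant). -/
inductive groupFunc : ℕ → Type
  | mul : groupFunc 2
  | inv : groupFunc 1
  | one : groupFunc 0

/-- The first-order language of groups. -/
def groupLang : FirstOrder.Language :=
  { Functions := groupFunc, Relations := fun _ => Empty }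

/-- The canonical `groupLang`-structure on a group. -/
def groupStructure (G : Type*) [Group G] : groupLang.Structure G where
  funMap {n} f x :=
    match f with
    | .mul => x 0 * x 1
    | .inv => (x 0)⁻¹
    | .one => 1
  RelMap {n} r _ := r.elim

/-- The stable linear group `GL(K)`: the group of `ℕ × ℕ` matrices over `K` that
differ from the identity in only finitely many entries and are invertible;
realized as the group of `K`-linear automorphisms of `ℕ →₀ K` fixing all but
finitely many of the standard basis vectors. -/
def StableGL (K : Type*) [Field K] : Subgroup ((ℕ →₀ K) ≃ₗ[K] (ℕ →₀ K)) where
  carrier := {f | {j : ℕ | f (Finsupp.single j 1) ≠ Finsupp.single j 1}.Finite}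
  one_mem' := by
    show Set.Finite _
    have h1 : {j : ℕ | (1 : (ℕ →₀ K) ≃ₗ[K] (ℕ →₀ K)) (Finsupp.single j 1) ≠
        Finsupp.single j 1} = ∅ := by
      ext j
      simp [LinearEquiv.coe_one]
    rw [h1]
    exact Set.finite_empty
  mul_mem' := by
    intro a b ha hb
    refine Set.Finite.subset (ha.union hb) ?_
    intro j hj
    by_contra h
    simp only [Set.mem_union, Set.mem_setOf_eq, not_or, not_not] at h
    exact hj (by
      show a (b (Finsupp.single j 1)) = Finsupp.single j 1
      rw [h.2, h.1])
  inv_mem' := by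
    intro a ha
    refine Set.Finite.subset ha ?_
    intro j hj
    by_contra h
    simp only [Set.mem_setOf_eq, not_not] at h
    refine hj ?_
    have h2 : a⁻¹ (a (Finsupp.single j 1)) = Finsupp.single j 1 :=
      a.symm_apply_apply _
    rwa [h] at h2

namespace StableGL

/-- A linear endomorphism (or functional) vanishes on almost all standard basis vectors. -/
def Finitary {K W : Type*} [Field K] [AddCommGroup W] [Module K W]
    (T : (ℕ →₀ K) →ₗ[K] W) : Prop :=
  {j : ℕ | T (Finsupp.single j 1) ≠ 0}.Finite

namespace Finitary

variable {K W : Type*} [Field K] [AddCommGroup W] [Module K W]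

theorem add {T S : (ℕ →₀ K) →ₗ[K] W} (hT : Finitary T) (hS : Finitary S) :
    Finitary (T + S) := by
  refine (hT.union hS).subset fun j hj => ?_
  by_contra h
  simp only [Set.mem_union, Set.mem_ofPred_eq, not_or, not_not] at h
  exact hj (by simp [h.1, h.2])

theorem sub {T S : (ℕ →₀ K) →ₗ[K] W} (hT : Finitary T) (hS : Finitary S) :
    Finitary (T - S) := by
  refine (hT.union hS).subset fun j hj => ?_
  by_contra h
  simp only [Set.mem_union, Set.mem_ofPred_eq, not_or, not_not] at h
  exact hj (by simp [h.1, h.2])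

theorem comp {W' : Type*} [AddCommGroup W'] [Module K W'] {T : (ℕ →₀ K) →ₗ[K] W}
    (hT : Finitary T) (A : W →ₗ[K] W') : Finitary (A ∘ₗ T) := by
  refine hT.subset fun j hj h => hj ?_
  simp [h]

theorem smul {T : (ℕ →₀ K) →ₗ[K] W} (hT : Finitary T) (a : K) : Finitary (a • T) := by
  refine hT.subset fun j hj h => hj ?_
  simp [h]

theorem smulRight {h : (ℕ →₀ K) →ₗ[K] K} (hh : Finitary h) (w : W) :
    Finitary (h.smulRight w) := by
  refine hh.subset fun j hj h' => hj ?_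
  simp [h']

theorem lapply (j : ℕ) : Finitary (Finsupp.lapply j : (ℕ →₀ K) →ₗ[K] K) := by
  refine (Set.finite_singleton j).subset fun i hi => ?_
  by_contra h
  exact hi (by simpa [Finsupp.single_apply] using h)

theorem finite_coord {T : Module.End K (ℕ →₀ K)} (hT : Finitary T) :
    {j : ℕ | ∃ v, T v j ≠ 0}.Finite := by
  refine (hT.biUnion fun s _ => (T (Finsupp.single s 1)).support.finite_toSet).subset ?_
  intro j ⟨v, hv⟩
  by_contra hj
  refine hv ?_
  have h0 : (Finsupp.lapply j : (ℕ →₀ K) →ₗ[K] K) ∘ₗ T = 0 := by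
    ext s
    simp only [Set.mem_iUnion, not_exists] at hj
    by_cases hs : T (Finsupp.single s 1) = 0
    · simp [hs]
    · simpa using hj s hs
  exact LinearMap.congr_fun h0 v

end Finitary

variable {K : Type*} [Field K]

/-- The underlying linear endomorphism of an element of the stable linear group. -/
def toEnd (x : StableGL K) : Module.End K (ℕ →₀ K) := (x.1 : (ℕ →₀ K) →ₗ[K] (ℕ →₀ K))

theorem toEnd_injective : Function.Injective (toEnd (K := K)) := fun _ _ h =>
  Subtype.ext (LinearEquiv.toLinearMap_injective h)

@[simp] theorem toEnd_mul (x y : StableGL K) : toEnd (x * y) = toEnd x * toEnd y := rfl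

@[simp] theorem toEnd_one : toEnd (1 : StableGL K) = 1 := rfl

theorem toEnd_commute {x y : StableGL K} : Commute (toEnd x) (toEnd y) ↔ Commute x y :=
  ⟨fun h => toEnd_injective h.eq, fun h => congrArg toEnd h.eq⟩

instance : IsLeftCancelAdd (Module.End K (ℕ →₀ K)) :=
  ⟨fun _ _ _ h => LinearMap.ext fun v => add_left_cancel (LinearMap.congr_fun h v)⟩

theorem isUnit_one_add_of_isNilpotent {T : Module.End K (ℕ →₀ K)} (hT : IsNilpotent T) :
    IsUnit (1 + T) :=
  IsNilpotent.isUnit_one_add (R := Module.End K (ℕ →₀ K)) hT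

theorem finitary_toEnd_sub_one (x : StableGL K) : Finitary (toEnd x - 1) := by
  refine Set.Finite.subset x.2 fun j hj h => hj ?_
  rw [LinearMap.sub_apply, sub_eq_zero]
  exact h

theorem exists_toEnd_eq {T : Module.End K (ℕ →₀ K)} (hT : Finitary T) (hu : IsUnit (1 + T)) :
    ∃ x : StableGL K, toEnd x = 1 + T := by
  obtain ⟨u, hu⟩ := hu
  have hval : ∀ v, u.val v = v + T v := fun v => by rw [hu]; rfl
  refine ⟨⟨LinearEquiv.ofLinearMap u.val u.inv u.val_inv u.inv_val, ?_⟩, ?_⟩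
  · refine hT.subset fun j hj h => hj ?_
    change u.val _ = _
    rw [hval, h, add_zero]
  · rw [← hu]
    rfl

section DoubleCentralizer

variable {N M : Module.End K (ℕ →₀ K)}

theorem apply_eq_zero_of_commute (hN : Finitary N) (hM : Finitary M)
    (hc : ∀ T : Module.End K (ℕ →₀ K), Finitary T → IsNilpotent T → Commute T N → Commute T M)
    {w : ℕ →₀ K} (hw : N w = 0) : M w = 0 := by
  obtain ⟨j, hj⟩ := ((hN.finite_coord.union hM.finite_coord).union
    w.support.finite_toSet).exists_notMem
  simp only [Set.mem_union, Set.mem_ofPred_eq, not_or, not_exists, not_not, Finset.mem_coe,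
    Finsupp.mem_support_iff] at hj
  obtain ⟨⟨hjN, hjM⟩, hjw⟩ := hj
  set T : Module.End K (ℕ →₀ K) :=
    (Finsupp.lapply j : (ℕ →₀ K) →ₗ[K] K).smulRight w
  have hTa : ∀ v, T v = v j • w := fun v => rfl
  have hT : Commute T M := by
    refine hc T ((Finitary.lapply j).smulRight w) ⟨2, ?_⟩ ?_
    · refine LinearMap.ext fun v => ?_
      simp [pow_two, hTa, hjw]
    · refine LinearMap.ext fun v => ?_
      simp [hTa, hjN, hw]
  have h := LinearMap.congr_fun hT.eq (Finsupp.single j 1)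
  simpa [hTa, hjM] using h.symm

theorem functional_eq_zero_of_commute (hN : Finitary N) (hM : Finitary M)
    (hc : ∀ T : Module.End K (ℕ →₀ K), Finitary T → IsNilpotent T → Commute T N → Commute T M)
    {h : (ℕ →₀ K) →ₗ[K] K} (hh : Finitary h) (hhN : ∀ v, h (N v) = 0) (v : ℕ →₀ K) :
    h (M v) = 0 := by
  obtain ⟨e, he, heN, heM, heh⟩ : ∃ e : ℕ →₀ K, e ≠ 0 ∧ N e = 0 ∧ M e = 0 ∧ h e = 0 := by
    obtain ⟨j, hj⟩ := ((hN.union hM).union hh).exists_notMem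
    simp only [Set.mem_union, Set.mem_ofPred_eq, not_or, not_not] at hj
    exact ⟨Finsupp.single j 1, by simp, hj.1.1, hj.1.2, hj.2⟩
  set T : Module.End K (ℕ →₀ K) := h.smulRight e
  have hTa : ∀ v, T v = h v • e := fun v => rfl
  have hT : Commute T M := by
    refine hc T (hh.smulRight _) ⟨2, ?_⟩ ?_
    · refine LinearMap.ext fun v => ?_
      simp [pow_two, hTa, heh]
    · refine LinearMap.ext fun v => ?_
      simp [hTa, heN, hhN]
  have h' := LinearMap.congr_fun hT.eq v
  simpa [hTa, heM, he] using h'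

theorem exists_eq_smul_of_commute (hN : Finitary N) (hN2 : ∀ v, N (N v) = 0)
    (hM : Finitary M)
    (hc : ∀ T : Module.End K (ℕ →₀ K), Finitary T → IsNilpotent T → Commute T N → Commute T M) :
    ∃ a : K, M = a • N := by
  have hMN : ∀ v, M (N v) = 0 := fun v => apply_eq_zero_of_commute hN hM hc (hN2 v)
  have hNM : ∀ v, N (M v) = 0 := fun v => by
    ext j
    exact functional_eq_zero_of_commute hN hM hc (h := Finsupp.lapply j ∘ₗ N)
      (hN.comp _) (fun v => by simp [hN2]) v
  have hcross : ∀ (u : ℕ →₀ K) (h : (ℕ →₀ K) →ₗ[K] K), Finitary h → h (N u) = 0 →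
      ∀ y, h (N y) • M u = h (M y) • N u := by
    intro u h hh hu y
    set T : Module.End K (ℕ →₀ K) := (h ∘ₗ N).smulRight u + h.smulRight (N u)
    have hTa : ∀ v, T v = h (N v) • u + h v • N u := fun v => rfl
    have hT : Commute T M := by
      refine hc T (((hN.comp h).smulRight _).add (hh.smulRight _)) ⟨3, ?_⟩ ?_
      · refine LinearMap.ext fun v => ?_
        simp [pow_succ, hTa, hN2, hu]
      · refine LinearMap.ext fun v => ?_
        simp [hTa, hN2]
    have h' := LinearMap.congr_fun hT.eq y
    simpa [hTa, hNM, hMN] using h'.symm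
  by_cases hN0 : N = 0
  · refine ⟨0, LinearMap.ext fun v => ?_⟩
    simpa using apply_eq_zero_of_commute hN hM hc (w := v) (by simp [hN0])
  obtain ⟨y, hy⟩ : ∃ y, N y ≠ 0 := by
    by_contra! h
    exact hN0 (LinearMap.ext h)
  obtain ⟨i, hi⟩ := Finsupp.ne_iff.mp hy
  obtain ⟨f, hf, hfy⟩ : ∃ f : (ℕ →₀ K) →ₗ[K] K, Finitary f ∧ f (N y) = 1 :=
    ⟨(N y i)⁻¹ • Finsupp.lapply i, (Finitary.lapply i).smul _, by simpa using inv_mul_cancel₀ hi⟩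
  have hker : ∀ h : (ℕ →₀ K) →ₗ[K] K, Finitary h → h (N y) = 0 → h (M y) = 0 := by
    intro h hh hhy
    by_cases hhN : ∀ v, h (N v) = 0
    · exact functional_eq_zero_of_commute hN hM hc hh hhN y
    · push Not at hhN
      obtain ⟨z, hz⟩ := hhN
      have := congrArg h (hcross y h hh hhy z)
      simpa [hhy, hz] using this
  have hMy : M y = f (M y) • N y := by
    ext k
    have := hker (Finsupp.lapply k - (N y k) • f) ((Finitary.lapply k).sub (hf.smul _))
      (by simp [hfy])
    simp only [LinearMap.sub_apply, LinearMap.smul_apply, Finsupp.lapply_apply, smul_eq_mul,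
      sub_eq_zero] at this
    simp [this, mul_comm]
  refine ⟨f (M y), LinearMap.ext fun u => ?_⟩
  have h0 := hcross (u - f (N u) • y) f hf (by simp [hfy]) y
  rw [hfy, one_smul, map_sub, map_sub, map_smul, map_smul, hMy, smul_sub, map_smul, hfy,
    smul_comm (f (N u)), smul_eq_mul, mul_one] at h0
  simpa using h0

/-- Nonzero scalar multiples of a finitary square-zero endomorphism are conjugate to it. -/
theorem exists_conj_smul (hN : Finitary N) (hN2 : ∀ v, N (N v) = 0) {a : K} (ha : a ≠ 0) :
    ∃ g : StableGL K, toEnd g * N = (a • N) * toEnd g := by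
  classical
  obtain ⟨q, hq⟩ : ∃ q : (ℕ →₀ K) →ₗ[K] LinearMap.range N,
      q ∘ₗ (LinearMap.range N).subtype = LinearMap.id :=
    LinearMap.exists_leftInverse_of_injective _ (Submodule.ker_subtype _)
  set J : Set ℕ := {j | ∃ v, N v j ≠ 0}
  have hJfin : J.Finite := hN.finite_coord
  set D : Module.End K (ℕ →₀ K) :=
    (Finsupp.supported K K J).subtype ∘ₗ Finsupp.restrictDom K K J
  have hDa : ∀ v, D v = Finsupp.filter (· ∈ J) v := fun v => rfl
  have hDN : ∀ v, D (N v) = N v := fun v => by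
    rw [hDa, Finsupp.filter_eq_self_iff]
    exact fun j hj => ⟨v, hj⟩
  have hDfin : Finitary D := hJfin.subset fun j hj => by
    by_contra h
    exact hj (by rw [hDa, Finsupp.filter_single_of_neg _ h])
  set P : Module.End K (ℕ →₀ K) := (N.range.subtype ∘ₗ q) ∘ₗ D
  have hPfin : Finitary P := hDfin.comp _
  have hPN : P * N = N := LinearMap.ext fun v => by
    have := LinearMap.congr_fun hq ⟨N v, v, rfl⟩
    change (q (D (N v)) : ℕ →₀ K) = N v
    rw [hDN]
    exact congrArg Subtype.val this
  have hrange : ∀ v, ∃ u, N u = P v := fun v => (q (D v)).2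
  have hNP : N * P = 0 := LinearMap.ext fun v => by
    obtain ⟨u, hu⟩ := hrange v
    simp [← hu, hN2]
  have hPP : P * P = P := LinearMap.ext fun v => by
    obtain ⟨u, hu⟩ := hrange v
    rw [Module.End.mul_apply, ← hu]
    exact LinearMap.congr_fun hPN u
  have hmul : ∀ b c : K, b * c = 1 → (1 + (b - 1) • P) * (1 + (c - 1) • P) = 1 := by
    intro b c hbc
    have : (b - 1) * (c - 1) = 1 - b - c + 1 := by linear_combination hbc
    rw [mul_add, add_mul, add_mul, smul_mul_smul_comm, hPP, this, one_mul, mul_one, one_mul]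
    module
  obtain ⟨g, hg⟩ := exists_toEnd_eq (hPfin.smul (a - 1))
    ⟨⟨_, _, hmul a a⁻¹ (mul_inv_cancel₀ ha), hmul a⁻¹ a (inv_mul_cancel₀ ha)⟩, rfl⟩
  refine ⟨g, ?_⟩
  rw [hg, add_mul, smul_mul_assoc, hPN, mul_add, smul_mul_smul_comm, hNP,
    smul_zero, one_mul, mul_one, add_zero]
  module

end DoubleCentralizer

end StableGL

namespace StableGL

variable {K : Type*} [Field K]

theorem commute_toEnd_sub_one {x : StableGL K} {T : Module.End K (ℕ →₀ K)} :
    Commute T (toEnd x - 1) ↔ Commute T (toEnd x) := by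
  constructor <;> refine fun h => LinearMap.ext fun v => ?_ <;>
    simpa using LinearMap.congr_fun h.eq v

section Involution

variable [CharP K 2] {t : StableGL K}

theorem toEnd_sub_one_mul_self (ht : t * t = 1) : (toEnd t - 1) * (toEnd t - 1) = 0 := by
  refine LinearMap.ext fun v => ?_
  have h : toEnd t (toEnd t v) = v :=
    LinearMap.congr_fun ((toEnd_mul t t).symm.trans (congrArg toEnd ht)) v
  have hchar : ∀ w : ℕ →₀ K, w + w = 0 := fun w => by
    rw [← two_smul K, CharTwo.two_eq_zero, zero_smul]
  simp only [Module.End.mul_apply, LinearMap.sub_apply, Module.End.one_apply, map_sub, h,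
    LinearMap.zero_apply]
  rw [show v - toEnd t v - (toEnd t v - v) = (v + v) - (toEnd t v + toEnd t v) by abel, hchar,
    hchar, sub_zero]

theorem toEnd_sub_one_apply_apply (ht : t * t = 1) (v : ℕ →₀ K) :
    (toEnd t - 1) ((toEnd t - 1) v) = 0 :=
  LinearMap.congr_fun (toEnd_sub_one_mul_self ht) v

theorem exists_scale (ht : t * t = 1) (a : K) :
    ∃ x : StableGL K, toEnd x = 1 + a • (toEnd t - 1) := by
  refine exists_toEnd_eq ((finitary_toEnd_sub_one t).smul a) (isUnit_one_add_of_isNilpotent ⟨2, ?_⟩)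
  rw [pow_two, smul_mul_smul_comm, toEnd_sub_one_mul_self ht, smul_zero]

/-- The element `1 + a(t - 1)` attached to a scalar `a` and an element `t` of order at most two. -/
noncomputable def scale (ht : t * t = 1) (a : K) : StableGL K := (exists_scale ht a).choose

theorem toEnd_scale (ht : t * t = 1) (a : K) : toEnd (scale ht a) = 1 + a • (toEnd t - 1) :=
  (exists_scale ht a).choose_spec

theorem scale_zero (ht : t * t = 1) : scale ht 0 = 1 :=
  toEnd_injective (by simp [toEnd_scale])

theorem scale_one (ht : t * t = 1) : scale ht 1 = t :=
  toEnd_injective (by rw [toEnd_scale]; module)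

theorem scale_add (ht : t * t = 1) (a b : K) : scale ht (a + b) = scale ht a * scale ht b := by
  refine toEnd_injective ?_
  rw [toEnd_mul, toEnd_scale, toEnd_scale, toEnd_scale, mul_add, add_mul, add_mul,
    smul_mul_smul_comm, toEnd_sub_one_mul_self ht, smul_zero, one_mul, mul_one, add_smul, add_zero,
    one_mul, add_assoc]

theorem scale_injective (ht : t * t = 1) (ht1 : t ≠ 1) : Function.Injective (scale ht) := by
  intro a b h
  have hN : toEnd t - 1 ≠ 0 := fun h0 => ht1 (toEnd_injective (sub_eq_zero.mp h0))
  have h' := congrArg toEnd h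
  rw [toEnd_scale, toEnd_scale, add_right_inj] at h'
  obtain ⟨v, hv⟩ : ∃ v, (toEnd t - 1) v ≠ 0 := by
    by_contra! h0
    exact hN (LinearMap.ext h0)
  exact smul_left_injective K hv (LinearMap.congr_fun h' v)

/-- The double centralizer of an involution `t` consists of the elements `1 + a(t - 1)`. -/
theorem exists_scale_eq_iff (ht : t * t = 1) (x : StableGL K) :
    (∃ a, scale ht a = x) ↔ ∀ g : StableGL K, g * t = t * g → g * x = x * g := by
  constructor
  · rintro ⟨a, rfl⟩ g hg
    rw [← commute_iff_eq, ← toEnd_commute, toEnd_scale]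
    exact (Commute.one_right _).add_right
      ((commute_toEnd_sub_one.mpr (toEnd_commute.mpr hg)).smul_right a)
  · intro h
    obtain ⟨a, ha⟩ := exists_eq_smul_of_commute (finitary_toEnd_sub_one t)
      (toEnd_sub_one_apply_apply ht) (finitary_toEnd_sub_one x) fun T hT hnil hTN => by
        obtain ⟨g, hg⟩ := exists_toEnd_eq hT (isUnit_one_add_of_isNilpotent hnil)
        have hgt : Commute (toEnd g) (toEnd t) := by
          rw [hg]
          exact (Commute.one_left _).add_left (commute_toEnd_sub_one.mp hTN)
        have hgx : Commute (toEnd g) (toEnd x) :=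
          toEnd_commute.mpr (h g (toEnd_commute.mp hgt).eq)
        rw [hg] at hgx
        rw [commute_toEnd_sub_one]
        exact LinearMap.ext fun v => by simpa using LinearMap.congr_fun hgx.eq v
    exact ⟨a, toEnd_injective (by rw [toEnd_scale, ← ha]; module)⟩

theorem mul_scale_eq_iff (ht : t * t = 1) (g : StableGL K) (a b : K) :
    g * scale ht a = scale ht b * g ↔
      toEnd g * (a • (toEnd t - 1)) = (b • (toEnd t - 1)) * toEnd g := by
  rw [← toEnd_injective.eq_iff, toEnd_mul, toEnd_mul, toEnd_scale, toEnd_scale, mul_add, add_mul,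
    mul_one, one_mul, add_right_inj]

/-- Multiplication of scalars is expressed by conjugation. -/
theorem mul_eq_iff_scale (ht : t * t = 1) (ht1 : t ≠ 1) (a b c : K) :
    c = a * b ↔ (scale ht a = 1 ∧ scale ht c = 1) ∨
      ∃ g : StableGL K, g * t = scale ht a * g ∧ g * scale ht b = scale ht c * g := by
  have hinj := scale_injective ht ht1
  have hmul : ∀ (g : StableGL K) (b : K), g * t = scale ht a * g →
      g * scale ht b = scale ht (a * b) * g := by
    intro g b hg
    have h1 := (mul_scale_eq_iff ht g 1 a).mp (by rwa [scale_one])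
    rw [mul_scale_eq_iff, mul_smul_comm]
    rw [one_smul] at h1
    rw [h1, mul_comm a b, mul_smul, smul_mul_assoc b]
  constructor
  · rintro rfl
    by_cases ha : a = 0
    · exact Or.inl (by simp [ha, scale_zero])
    · obtain ⟨g, hg⟩ := exists_conj_smul (finitary_toEnd_sub_one t)
        (toEnd_sub_one_apply_apply ht) ha
      have hg' : g * t = scale ht a * g := by
        simpa [scale_one] using (mul_scale_eq_iff ht g 1 a).mpr (by rwa [one_smul])
      exact Or.inr ⟨g, hg', hmul g b hg'⟩
  · rintro (⟨ha, hc⟩ | ⟨g, hg, hgb⟩)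
    · rw [← scale_zero ht] at ha hc
      rw [hinj ha, hinj hc, zero_mul]
    · rw [hmul g b hg] at hgb
      exact (hinj (mul_right_cancel hgb)).symm

end Involution

theorem exists_involution (K : Type*) [Field K] [CharP K 2] :
    ∃ t : StableGL K, t * t = 1 ∧ t ≠ 1 := by
  set N : Module.End K (ℕ →₀ K) :=
    (Finsupp.lapply 0 : (ℕ →₀ K) →ₗ[K] K).smulRight (Finsupp.single 1 1)
  have hNa : ∀ v, N v = v 0 • Finsupp.single 1 1 := fun v => rfl
  have hNN : N * N = 0 := LinearMap.ext fun v => by simp [hNa]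
  obtain ⟨t, ht⟩ := exists_toEnd_eq (T := N) ((Finitary.lapply 0).smulRight _)
    (isUnit_one_add_of_isNilpotent ⟨2, by rw [pow_two, hNN]⟩)
  refine ⟨t, toEnd_injective ?_, ?_⟩
  · rw [toEnd_mul, ht, toEnd_one, mul_add, add_mul, add_mul, hNN, one_mul, mul_one, one_mul,
      add_zero, add_assoc, ← two_smul K N, CharTwo.two_eq_zero, zero_smul, add_zero]
  · rintro rfl
    have h := DFunLike.congr_fun (LinearMap.congr_fun ht (Finsupp.single 0 1)) 1
    simp [hNa] at h

end StableGL

namespace FirstOrder.Language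

/-- Relations on a family of sets `N i`, coded by injections `e i` in `L`-structures `M i`, that
are defined by one and the same `L`-formula in all the `M i`, with the parameter `c i`. -/
def UniformlyDefinable (L : Language) {ι : Type*} {M N : ι → Type*} [∀ i, L.Structure (M i)]
    (c : ∀ i, M i) (e : ∀ i, N i → M i) {α : Type*} (R : ∀ i, (α → N i) → Prop) : Prop :=
  ∃ φ : L.Formula (Option α), ∀ i (x : α → N i),
    φ.Realize (fun o => o.elim (c i) (fun a => e i (x a))) ↔ R i x

/-- The ranges of the codings `e i` are defined by one and the same `L`-formula in all the `M i`,
with the parameter `c i`. -/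
def UniformlyDefinableRange (L : Language) {ι : Type*} {M N : ι → Type*} [∀ i, L.Structure (M i)]
    (c : ∀ i, M i) (e : ∀ i, N i → M i) : Prop :=
  ∃ δ : L.Formula (Option Unit), ∀ i (x : M i),
    δ.Realize (fun o => o.elim (c i) (fun _ => x)) ↔ ∃ a, e i a = x

namespace UniformlyDefinable

variable {L : Language} {ι : Type*} {M N : ι → Type*} [∀ i, L.Structure (M i)]
  {c : ∀ i, M i} {e : ∀ i, N i → M i} {α β : Type*}

theorem congr {R S : ∀ i, (α → N i) → Prop} (hR : UniformlyDefinable L c e R)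
    (h : ∀ i x, R i x ↔ S i x) : UniformlyDefinable L c e S := by
  obtain ⟨φ, hφ⟩ := hR
  exact ⟨φ, fun i x => (hφ i x).trans (h i x)⟩

theorem false : UniformlyDefinable L c e (fun _ (_ : α → _) => False) :=
  ⟨⊥, fun _ _ => Iff.rfl⟩

theorem imp {R S : ∀ i, (α → N i) → Prop} (hR : UniformlyDefinable L c e R)
    (hS : UniformlyDefinable L c e S) : UniformlyDefinable L c e (fun i x => R i x → S i x) := by
  obtain ⟨φ, hφ⟩ := hR
  obtain ⟨ψ, hψ⟩ := hS
  exact ⟨φ.imp ψ, fun i x => by rw [Formula.realize_imp, hφ, hψ]⟩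

theorem not {R : ∀ i, (α → N i) → Prop} (hR : UniformlyDefinable L c e R) :
    UniformlyDefinable L c e (fun i x => ¬ R i x) :=
  hR.imp false

theorem and {R S : ∀ i, (α → N i) → Prop} (hR : UniformlyDefinable L c e R)
    (hS : UniformlyDefinable L c e S) : UniformlyDefinable L c e (fun i x => R i x ∧ S i x) := by
  obtain ⟨φ, hφ⟩ := hR
  obtain ⟨ψ, hψ⟩ := hS
  exact ⟨φ ⊓ ψ, fun i x => by rw [Formula.realize_inf, hφ, hψ]⟩

theorem forall_finite [Finite β] {R : β → ∀ i, (α → N i) → Prop}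
    (hR : ∀ b, UniformlyDefinable L c e (R b)) :
    UniformlyDefinable L c e (fun i x => ∀ b, R b i x) := by
  choose φ hφ using hR
  exact ⟨Formula.iInf φ, fun i x => by
    rw [Formula.realize_iInf]
    exact forall_congr' fun b => hφ b i x⟩

theorem comp {R : ∀ i, (α → N i) → Prop} (hR : UniformlyDefinable L c e R) (f : α → β) :
    UniformlyDefinable L c e (fun i x => R i (x ∘ f)) := by
  obtain ⟨φ, hφ⟩ := hR
  refine ⟨φ.relabel (Option.map f), fun i x => ?_⟩
  rw [Formula.realize_relabel]
  refine Iff.trans ?_ (hφ i (x ∘ f))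
  refine iff_of_eq (congrArg _ (funext fun o => ?_))
  cases o <;> rfl

theorem exists_finite [Finite β]
    (hdom : UniformlyDefinableRange L c e)
    {R : ∀ i, (α ⊕ β → N i) → Prop} (hR : UniformlyDefinable L c e R) :
    UniformlyDefinable L c e (fun i x => ∃ y : β → N i, R i (Sum.elim x y)) := by
  obtain ⟨δ, hδ⟩ := hdom
  obtain ⟨φ, hφ⟩ := hR
  refine ⟨Formula.iExs β (φ.relabel (fun o : Option (α ⊕ β) => o.elim (Sum.inl none)
    (Sum.elim (fun a => Sum.inl (some a)) Sum.inr)) ⊓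
    Formula.iInf fun b => δ.relabel (fun o : Option Unit => o.elim (Sum.inl none)
      (fun _ => Sum.inr b))), fun i x => ?_⟩
  simp only [Formula.realize_iExs, Formula.realize_inf, Formula.realize_iInf,
    Formula.realize_relabel]
  have hval : ∀ y : β → N i, (Sum.elim (fun o : Option α => o.elim (c i) (fun a => e i (x a)))
      (fun b => e i (y b)) ∘ fun o : Option (α ⊕ β) => o.elim (Sum.inl none)
      (Sum.elim (fun a => Sum.inl (some a)) Sum.inr)) =
      fun o => o.elim (c i) (fun a => e i (Sum.elim x y a)) := fun y => by
    funext o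
    rcases o with _ | _ | _ <;> rfl
  have hdel : ∀ (y : β → M i) (b : β),
      (Sum.elim (fun o : Option α => o.elim (c i) (fun a => e i (x a))) y ∘
        fun o : Option Unit => o.elim (Sum.inl none) (fun _ => Sum.inr b)) =
      fun o => o.elim (c i) (fun _ => y b) := fun y b => by
    funext o
    cases o <;> rfl
  simp only [hdel, hδ]
  constructor
  · rintro ⟨y, hy, hd⟩
    choose z hz using hd
    obtain rfl : (fun b => e i (z b)) = y := funext hz
    exact ⟨z, (hφ _ _).mp (by rwa [hval] at hy)⟩
  · rintro ⟨z, hz⟩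
    refine ⟨fun b => e i (z b), ?_, fun b => ⟨z b, rfl⟩⟩
    rw [hval]
    exact (hφ _ _).mpr hz

end UniformlyDefinable

section Interpretation

variable {L L' : Language} {ι : Type*} {M N : ι → Type*} [∀ i, L.Structure (M i)]
  [∀ i, L'.Structure (N i)] {c : ∀ i, M i} {e : ∀ i, N i → M i} {α : Type*}

theorem uniformlyDefinable_term_eq (hdom : UniformlyDefinableRange L c e)
    (heq : UniformlyDefinable L c e (fun _ (x : Option Unit → _) => x none = x (some ())))
    (hfun : ∀ {n : ℕ} (f : L'.Functions n), UniformlyDefinable L c e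
      (fun _ (x : Option (Fin n) → _) => x none = Structure.funMap f (fun j => x (some j))))
    (τ : L'.Term α) :
    UniformlyDefinable L c e
      (fun _ (x : Option α → _) => x none = τ.realize (fun a => x (some a))) := by
  induction τ with
  | var a => exact (heq.comp (Option.map fun _ => a)).congr fun i x => Iff.rfl
  | @func n f ts ih =>
    refine (UniformlyDefinable.exists_finite (β := Fin n) hdom
      ((UniformlyDefinable.forall_finite fun j => (ih j).comp
        (fun o : Option α => o.elim (Sum.inr j) (fun a => Sum.inl (some a)))).and
      ((hfun f).comp (fun o : Option (Fin n) => o.elim (Sum.inl none) Sum.inr)))).congr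
      fun i x => ?_
    constructor
    · rintro ⟨y, hy, h⟩
      obtain rfl : y = fun j => (ts j).realize (fun a => x (some a)) := funext hy
      exact h
    · exact fun h => ⟨fun j => (ts j).realize (fun a => x (some a)), fun j => rfl, h⟩

theorem uniformlyDefinable_realize (hdom : UniformlyDefinableRange L c e)
    (heq : UniformlyDefinable L c e (fun _ (x : Option Unit → _) => x none = x (some ())))
    (hfun : ∀ {n : ℕ} (f : L'.Functions n), UniformlyDefinable L c e
      (fun _ (x : Option (Fin n) → _) => x none = Structure.funMap f (fun j => x (some j))))
    (hrel : ∀ {n : ℕ} (r : L'.Relations n), UniformlyDefinable L c e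
      (fun _ (x : Fin n → _) => Structure.RelMap r x))
    {n : ℕ} (φ : L'.BoundedFormula α n) :
    UniformlyDefinable L c e
      (fun _ (x : α ⊕ Fin n → _) => φ.Realize (x ∘ Sum.inl) (x ∘ Sum.inr)) := by
  have helim : ∀ {n : ℕ} {i : ι} (x : α ⊕ Fin n → N i),
      Sum.elim (x ∘ Sum.inl) (x ∘ Sum.inr) = x := fun x => Sum.elim_comp_inl_inr x
  induction φ with
  | falsum => exact UniformlyDefinable.false
  | @equal n t₁ t₂ =>
    have h := fun τ : L'.Term (α ⊕ Fin n) =>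
      (uniformlyDefinable_term_eq hdom heq hfun τ).comp
        (fun o : Option (α ⊕ Fin n) => (o.elim (Sum.inr ()) Sum.inl : (α ⊕ Fin n) ⊕ Unit))
    refine (UniformlyDefinable.exists_finite hdom ((h t₁).and (h t₂))).congr fun i x => ?_
    simp only [BoundedFormula.Realize, helim]
    constructor
    · rintro ⟨y, h₁, h₂⟩
      exact h₁.symm.trans h₂
    · exact fun h => ⟨fun _ => t₁.realize x, rfl, h⟩
  | @rel n k r ts =>
    refine (UniformlyDefinable.exists_finite (β := Fin k) hdom
      ((UniformlyDefinable.forall_finite fun j =>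
        (uniformlyDefinable_term_eq hdom heq hfun (ts j)).comp
          (fun o : Option (α ⊕ Fin n) => o.elim (Sum.inr j) Sum.inl)).and
      ((hrel r).comp Sum.inr))).congr fun i x => ?_
    simp only [BoundedFormula.Realize, helim]
    constructor
    · rintro ⟨y, hy, h⟩
      obtain rfl : y = fun j => (ts j).realize x := funext hy
      exact h
    · exact fun h => ⟨fun j => (ts j).realize x, fun j => rfl, h⟩
  | imp _ _ ih₁ ih₂ => exact ih₁.imp ih₂
  | @all n φ ih =>
    refine (UniformlyDefinable.exists_finite hdom (ih.comp (Sum.elim (fun a => Sum.inl (Sum.inl a))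
      (Fin.snoc (fun j : Fin n => Sum.inl (Sum.inr j)) (Sum.inr ()) :
        Fin (n + 1) → (α ⊕ Fin n) ⊕ Unit))).not).not.congr fun i x => ?_
    have hval : ∀ y : Unit → N i, (Sum.elim x y ∘ Sum.elim (fun a => Sum.inl (Sum.inl a))
        (Fin.snoc (fun j : Fin n => Sum.inl (Sum.inr j)) (Sum.inr ()) :
          Fin (n + 1) → (α ⊕ Fin n) ⊕ Unit)) ∘ Sum.inr =
        (Fin.snoc (x ∘ Sum.inr) (y ()) : Fin (n + 1) → N i) := fun y => by
      funext j
      refine Fin.lastCases ?_ (fun j => ?_) j <;> simp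
    simp only [hval, not_exists, not_not, BoundedFormula.Realize]
    exact ⟨fun h a => h (fun _ => a), fun h y => h (y ())⟩

end Interpretation

end FirstOrder.Language

namespace StableGL

open FirstOrder Language

attribute [local instance] groupStructure

/-- The product of two terms in the language of groups. -/
def mulTerm {α : Type*} (s t : groupLang.Term α) : groupLang.Term α :=
  Term.func (L := groupLang) groupFunc.mul ![s, t]

/-- The identity term in the language of groups. -/
def oneTerm {α : Type*} : groupLang.Term α :=
  Term.func (L := groupLang) groupFunc.one ![]

theorem realize_mulTerm {G α : Type*} [Group G] (s t : groupLang.Term α) (v : α → G) :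
    (mulTerm s t).realize v = s.realize v * t.realize v := rfl

theorem realize_oneTerm {G α : Type*} [Group G] (v : α → G) :
    (oneTerm : groupLang.Term α).realize v = 1 := rfl

/-- A field of characteristic two with an involution in its stable linear group. -/
structure FieldWithInvolution where
  carrier : Type
  [field : Field carrier]
  [charP : CharP carrier 2]
  involution : StableGL carrier
  mul_self : involution * involution = 1
  ne_one : involution ≠ 1

namespace FieldWithInvolution

instance (i : FieldWithInvolution) : Field i.carrier := i.field

instance (i : FieldWithInvolution) : CharP i.carrier 2 := i.charP

instance (i : FieldWithInvolution) : Language.ring.Structure i.carrier :=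
  (FirstOrder.Ring.compatibleRingOfRing i.carrier).toStructure

/-- The coding of scalars by elements of the double centralizer of the involution. -/
noncomputable def code (i : FieldWithInvolution) : i.carrier → StableGL i.carrier :=
  scale i.mul_self

theorem code_injective (i : FieldWithInvolution) : Function.Injective i.code :=
  scale_injective i.mul_self i.ne_one

theorem uniformlyDefinableRange_code :
    UniformlyDefinableRange groupLang involution code := by
  let g : groupLang.Term (Option Unit ⊕ Fin 1) := Term.var (Sum.inr 0)
  let t : groupLang.Term (Option Unit ⊕ Fin 1) := Term.var (Sum.inl none)
  let x : groupLang.Term (Option Unit ⊕ Fin 1) := Term.var (Sum.inl (some ()))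
  refine ⟨((mulTerm g t).bdEqual (mulTerm t g) |>.imp
    ((mulTerm g x).bdEqual (mulTerm x g))).all, fun i y => ?_⟩
  rw [code, exists_scale_eq_iff]
  simp [Formula.Realize, realize_mulTerm, g, t, x, Fin.snoc]

theorem uniformlyDefinable_eq :
    UniformlyDefinable groupLang involution code
      (fun _ (x : Option Unit → _) => x none = x (some ())) := by
  refine ⟨Term.equal (Term.var (some none)) (Term.var (some (some ()))), fun i x => ?_⟩
  simp [i.code_injective.eq_iff]

theorem uniformlyDefinable_funMap {n : ℕ} (f : Language.ring.Functions n) :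
    UniformlyDefinable groupLang involution code
      (fun _ (x : Option (Fin n) → _) => x none = Structure.funMap f (fun j => x (some j))) := by
  cases f with
  | add =>
    refine ⟨Term.equal (Term.var (some none))
      (mulTerm (Term.var (some (some 0))) (Term.var (some (some 1)))), fun i x => ?_⟩
    rw [Formula.realize_equal, realize_mulTerm]
    change i.code _ = i.code _ * i.code _ ↔ x none = x (some 0) + x (some 1)
    rw [code, ← scale_add, (scale_injective i.mul_self i.ne_one).eq_iff]
  | mul =>
    let g : groupLang.Term (Option (Option (Fin 2)) ⊕ Fin 1) := Term.var (Sum.inr 0)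
    let t : groupLang.Term (Option (Option (Fin 2)) ⊕ Fin 1) := Term.var (Sum.inl none)
    let v (j : Option (Fin 2)) : groupLang.Term (Option (Option (Fin 2)) ⊕ Fin 1) :=
      Term.var (Sum.inl (some j))
    refine ⟨(Term.equal (Term.var (some (some 0))) oneTerm ⊓
        Term.equal (Term.var (some none)) oneTerm) ⊔
      ((mulTerm g t).bdEqual (mulTerm (v (some 0)) g) ⊓
        (mulTerm g (v (some 1))).bdEqual (mulTerm (v none) g)).ex, fun i x => ?_⟩
    change _ ↔ x none = x (some 0) * x (some 1)
    rw [mul_eq_iff_scale i.mul_self i.ne_one, Formula.realize_sup, Formula.realize_inf,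
      Formula.realize_equal, Formula.realize_equal, realize_oneTerm]
    simp [Formula.Realize, realize_mulTerm, g, t, v, Fin.snoc, code]
  | neg =>
    refine ⟨Term.equal (Term.var (some none)) (Term.var (some (some 0))), fun i x => ?_⟩
    change _ ↔ x none = -x (some 0)
    rw [CharTwo.neg_eq, ← i.code_injective.eq_iff]
    rfl
  | zero =>
    refine ⟨Term.equal (Term.var (some none)) oneTerm, fun i x => ?_⟩
    change _ ↔ x none = 0
    rw [← i.code_injective.eq_iff, Formula.realize_equal, realize_oneTerm, code, scale_zero]
    rfl
  | one =>
    refine ⟨Term.equal (Term.var (some none)) (Term.var none), fun i x => ?_⟩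
    change _ ↔ x none = 1
    rw [← i.code_injective.eq_iff, code, scale_one]
    rfl

end FieldWithInvolution

/-- Every sentence about fields of characteristic two translates uniformly into a sentence about
their stable linear groups. -/
theorem exists_sentence_translation (φ : Language.ring.Sentence) :
    ∃ ψ : groupLang.Sentence, ∀ (K : Type) [Field K] [CharP K 2],
      (StableGL K ⊨ ψ) ↔
        @Sentence.Realize _ K (FirstOrder.Ring.compatibleRingOfRing K).toStructure φ := by
  obtain ⟨ψ, hψ⟩ := uniformlyDefinable_realize (L := groupLang)
    FieldWithInvolution.uniformlyDefinableRange_code FieldWithInvolution.uniformlyDefinable_eq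
    FieldWithInvolution.uniformlyDefinable_funMap (fun r => r.elim) φ
  let v : groupLang.Term (Empty ⊕ Unit) := Term.var (Sum.inr ())
  refine ⟨Formula.iExs Unit ((Term.equal (mulTerm v v) oneTerm ⊓ ∼(Term.equal v oneTerm)) ⊓
    ψ.relabel (fun o => o.elim (Sum.inr ()) (Sum.elim Sum.inl (fun j => j.elim0)))),
    fun K _ _ => ?_⟩
  have key : ∀ (t : StableGL K) (ht : t * t = 1) (ht1 : t ≠ 1) (w : Option (Empty ⊕ Fin 0) → _),
      w none = t → (ψ.Realize w ↔
        @Sentence.Realize _ K (FirstOrder.Ring.compatibleRingOfRing K).toStructure φ) := by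
    intro t ht ht1 w hw
    let i : FieldWithInvolution := ⟨K, t, ht, ht1⟩
    let x : Empty ⊕ Fin 0 → i.carrier := Sum.elim Empty.elim Fin.elim0
    obtain rfl : w = fun o => o.elim i.involution (fun a => i.code (x a)) := funext fun o => by
      rcases o with _ | a | j
      exacts [hw, a.elim, j.elim0]
    refine (hψ i x).trans (iff_of_eq ?_)
    exact congrArg₂ (@BoundedFormula.Realize _ K
      (FirstOrder.Ring.compatibleRingOfRing K).toStructure _ _ φ) (Subsingleton.elim _ _)
      (Subsingleton.elim _ _)
  rw [Sentence.Realize, Formula.realize_iExs]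
  simp only [Formula.realize_inf, Formula.realize_not, Formula.realize_equal, realize_mulTerm,
    realize_oneTerm, Formula.realize_relabel]
  constructor
  · rintro ⟨y, ⟨h1, h2⟩, h3⟩
    exact (key (y ()) h1 h2 _ rfl).mp h3
  · intro h
    obtain ⟨t, ht, ht1⟩ := exists_involution K
    exact ⟨fun _ => t, ⟨ht, ht1⟩, (key t ht ht1 _ rfl).mpr h⟩

end StableGL

theorem stable_GL_elementary_equivalence_implies_field_elementary_equivalence
    (K₁ K₂ : Type) [Field K₁] [Field K₂] [CharP K₁ 2] [CharP K₂ 2]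
    (h : @FirstOrder.Language.ElementarilyEquivalent groupLang
      (StableGL K₁) (StableGL K₂) (groupStructure _) (groupStructure _)) :
    @FirstOrder.Language.ElementarilyEquivalent FirstOrder.Language.ring K₁ K₂
      (FirstOrder.Ring.compatibleRingOfRing K₁).toStructure
      (FirstOrder.Ring.compatibleRingOfRing K₂).toStructure := by
  refine (@FirstOrder.Language.elementarilyEquivalent_iff _ _ _ (_) (_)).mpr fun φ => ?_
  obtain ⟨ψ, hψ⟩ := StableGL.exists_sentence_translation φ
  exact (hψ K₁).symm.trans
    (((@FirstOrder.Language.elementarilyEquivalent_iff _ _ _ (_) (_)).mp h ψ).trans (hψ K₂))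
end

section
/- Let K be a field of characteristic 2 containing a primitive cube root of unity, let n ≥ 4, and let d₁, …, d_n ∈ K satisfy d_i³ = 1 for all i. Assume that at least two of the d_i are different from 1 and at least two of the d_i are equal to 1, and let D = diag(d₁, …, d_n) ∈ GL_n(K). Then there exist three matrices M₁, M₂, M₃, pairwise non-conjugate in GL_n(K), such that each M_r has the form M_r = A_r B_r where A_r and B_r are each conjugate to D in GL_n(K) and A_r B_r = B_r A_r. -/
open Matrix in
theorem exists_isConj_coe_eq_diagonal_comp_perm {ι K : Type*} [Fintype ι] [DecidableEq ι]
    [Field K] (d : ι → K) (D : GL ι K) (hD : (D : Matrix ι ι K) = diagonal d)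
    (σ : Equiv.Perm ι) :
    ∃ B : GL ι K, IsConj D B ∧ (B : Matrix ι ι K) = diagonal (d ∘ σ) := by
  let P : GL ι K := ⟨σ.permMatrix K, σ⁻¹.permMatrix K,
    by rw [← permMatrix_mul]; simp, by rw [← permMatrix_mul]; simp⟩
  refine ⟨P * D * P⁻¹, isConj_iff.2 ⟨P, rfl⟩, ?_⟩
  change σ.permMatrix K * (D : Matrix ι ι K) * σ⁻¹.permMatrix K = _
  rw [hD, Equiv.Perm.permMatrix, PEquiv.toMatrix_toPEquiv_mul, Equiv.Perm.permMatrix,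
    PEquiv.mul_toMatrix_toPEquiv]
  ext i j
  have : Equiv.symm σ⁻¹ = σ := rfl
  simp [diagonal_apply, this]

open Matrix in
theorem card_filter_ne_one_eq_of_isConj_of_coe_eq_diagonal {ι K : Type*} [Fintype ι]
    [DecidableEq ι] [Field K] [DecidableEq K] {d e : ι → K} {M N : GL ι K}
    (hM : (M : Matrix ι ι K) = diagonal d) (hN : (N : Matrix ι ι K) = diagonal e)
    (h : IsConj M N) :
    (Finset.univ.filter fun i ↦ d i ≠ 1).card = (Finset.univ.filter fun i ↦ e i ≠ 1).card := by
  have rank_sub_one {w : ι → K} {X : GL ι K} (hX : (X : Matrix ι ι K) = diagonal w) :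
      (X - 1 : Matrix ι ι K).rank = (Finset.univ.filter fun i ↦ w i ≠ 1).card := by
    rw [hX, ← diagonal_one, diagonal_sub, rank_diagonal, Fintype.card_subtype]
    simp [sub_eq_zero]
  obtain ⟨U, rfl⟩ := isConj_iff.1 h
  rw [← rank_sub_one hM, ← rank_sub_one hN]
  have hU : ((U * M * U⁻¹ : GL ι K) - 1 : Matrix ι ι K) =
      (U : Matrix ι ι K) * (M - 1 : Matrix ι ι K) * (U⁻¹ : GL ι K) := by
    rw [mul_sub, sub_mul, mul_one, Units.mul_inv]
    rfl
  rw [hU, rank_mul_eq_left_of_isUnit_det _ _ ((isUnit_iff_isUnit_det _).1 (U⁻¹).isUnit),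
    rank_mul_eq_right_of_isUnit_det _ _ ((isUnit_iff_isUnit_det _).1 U.isUnit)]

theorem three_nonconjugate_products_of_conjugates_of_diagonal
    (K : Type*) [Field K] [CharP K 2] (ξ : K) (hξ : ξ ^ 3 = 1) (hξ1 : ξ ≠ 1)
    (n : ℕ) (hn : 4 ≤ n) (d : Fin n → K) (hd : ∀ i, d i ^ 3 = 1)
    (htwo_ne : ∃ i j : Fin n, i ≠ j ∧ d i ≠ 1 ∧ d j ≠ 1)
    (htwo_eq : ∃ i j : Fin n, i ≠ j ∧ d i = 1 ∧ d j = 1)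
    (D : Matrix.GeneralLinearGroup (Fin n) K)
    (hD : (D : Matrix (Fin n) (Fin n) K) = Matrix.diagonal d) :
    ∃ A₁ B₁ A₂ B₂ A₃ B₃ : Matrix.GeneralLinearGroup (Fin n) K,
      IsConj D A₁ ∧ IsConj D B₁ ∧ A₁ * B₁ = B₁ * A₁ ∧
      IsConj D A₂ ∧ IsConj D B₂ ∧ A₂ * B₂ = B₂ * A₂ ∧
      IsConj D A₃ ∧ IsConj D B₃ ∧ A₃ * B₃ = B₃ * A₃ ∧
      ¬ IsConj (A₁ * B₁) (A₂ * B₂) ∧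
      ¬ IsConj (A₁ * B₁) (A₃ * B₃) ∧
      ¬ IsConj (A₂ * B₂) (A₃ * B₃) := by
  classical
  obtain ⟨j₁, j₂, hj, hj₁, hj₂⟩ := htwo_ne
  obtain ⟨i₁, i₂, hi, hi₁, hi₂⟩ := htwo_eq
  have h₁₁ : i₁ ≠ j₁ := by rintro rfl; exact hj₁ hi₁
  have h₁₂ : i₁ ≠ j₂ := by rintro rfl; exact hj₂ hi₁
  have h₂₁ : i₂ ≠ j₁ := by rintro rfl; exact hj₁ hi₂
  have h₂₂ : i₂ ≠ j₂ := by rintro rfl; exact hj₂ hi₂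
  have sq_eq_one (i) : d i * d i = 1 ↔ d i = 1 := by
    have := hd i
    constructor <;> intro h <;> grind
  let T (σ : Equiv.Perm (Fin n)) := Finset.univ.filter fun i ↦ d i * d (σ i) ≠ 1
  have mem_T (ρ i) : i ∈ T ρ ↔ d i * d (ρ i) ≠ 1 := Finset.mem_filter_univ i
  let σ := Equiv.swap i₁ j₁
  let τ := Equiv.swap i₁ j₁ * Equiv.swap i₂ j₂
  have hσ : (T σ).card = (T 1).card + 1 := by
    have : T σ = insert i₁ (T 1) := by
      ext i
      simp only [mem_T, σ, Finset.mem_insert,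
        Equiv.Perm.one_apply, Equiv.swap_apply_def]
      grind
    rw [this, Finset.card_insert_of_notMem (by simp [mem_T, hi₁])]
  have hτ : (T τ).card = (T 1).card + 2 := by
    have : T τ = insert i₂ (T σ) := by
      ext i
      simp only [mem_T, σ, τ, Finset.mem_insert,
        Equiv.Perm.mul_apply, Equiv.swap_apply_def]
      grind
    rw [this, Finset.card_insert_of_notMem, hσ]
    simp [mem_T, σ, Equiv.swap_apply_of_ne_of_ne hi.symm h₂₁, hi₂]
  choose B hB hBd using exists_isConj_coe_eq_diagonal_comp_perm d D hD
  have coe_mul (ρ) : ((D * B ρ : Matrix.GeneralLinearGroup (Fin n) K) : Matrix (Fin n) (Fin n) K) =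
      Matrix.diagonal fun i ↦ d i * d (ρ i) := by
    rw [Units.val_mul, hD, hBd, Matrix.diagonal_mul_diagonal]
    rfl
  have comm (ρ) : D * B ρ = B ρ * D := by
    ext1
    simp only [Units.val_mul, hD, hBd, Matrix.diagonal_mul_diagonal, mul_comm]
  have card_eq {ρ ρ'} (h : IsConj (D * B ρ) (D * B ρ')) : (T ρ).card = (T ρ').card :=
    card_filter_ne_one_eq_of_isConj_of_coe_eq_diagonal (coe_mul ρ) (coe_mul ρ') h
  refine ⟨D, B 1, D, B σ, D, B τ, .refl D, hB _, comm _, .refl D, hB _, comm _,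
    .refl D, hB _, comm _, fun h ↦ ?_, fun h ↦ ?_, fun h ↦ ?_⟩ <;>
  · have := card_eq h
    omega
end

section
/- Let K be a field of characteristic 2 containing a primitive cube root of unity ξ, let n ≥ 4, and let A ∈ GL_n(K) satisfy A³ = 1, A ≠ 1, and rank(A − 1) ≤ n − 2. If the set { B·C : B and C are conjugate to A in GL_n(K) and B·C = C·B } meets at most two conjugacy classes of GL_n(K), then A is conjugate in GL_n(K) to diag(ξ, 1, …, 1) or to diag(ξ², 1, …, 1). -/
open Matrix

section

variable {K : Type*} [Field K] {n : ℕ}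

/-- The invertible diagonal matrix with the given units on the diagonal. -/
def diagonalGL : (Fin n → Kˣ) →* GL (Fin n) K :=
  (Units.map (diagonalRingHom (Fin n) K : (Fin n → K) →* Matrix (Fin n) (Fin n) K)).comp
    (MulEquiv.piUnits (M := fun _ : Fin n => K)).symm.toMonoidHom

lemma coe_diagonalGL (u : Fin n → Kˣ) :
    (diagonalGL u : Matrix (Fin n) (Fin n) K) = diagonal fun i => (u i : K) := rfl

/-- A matrix whose eigenvectors for nonzero eigenvalues span is diagonalizable. -/
lemma exists_isConj_diagonalGL (A : GL (Fin n) K)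
    (h : ⊤ ≤ Submodule.span K
      {v : Fin n → K | ∃ z : Kˣ, (A : Matrix (Fin n) (Fin n) K) *ᵥ v = (z : K) • v}) :
    ∃ u : Fin n → Kˣ, IsConj A (diagonalGL u) := by
  let b₀ := Module.Basis.ofSpan h
  let b : Module.Basis (Fin n) K (Fin n → K) :=
    b₀.reindex (b₀.indexEquiv (Pi.basisFun K (Fin n)))
  have hb : ∀ i, ∃ z : Kˣ, (A : Matrix (Fin n) (Fin n) K) *ᵥ b i = (z : K) • b i := fun i => by
    rw [Module.Basis.reindex_apply]
    exact Module.Basis.ofSpan_subset h ⟨_, rfl⟩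
  choose u hu using hb
  let := (Pi.basisFun K (Fin n)).invertibleToMatrix b
  refine ⟨u, IsConj.symm ⟨toUnits (unitOfInvertible ((Pi.basisFun K (Fin n)).toMatrix b)), ?_⟩⟩
  refine Units.ext ?_
  ext i j
  have := congrFun (hu j) i
  simp only [mulVec, dotProduct, Pi.smul_apply, smul_eq_mul] at this
  simp [coe_diagonalGL, mul_apply, Module.Basis.toMatrix_apply, diagonal_apply, this, mul_comm]

lemma sq_add_self_add_one_eq_zero {x : Kˣ} (hx : x ^ 3 = 1) (hx1 : x ≠ 1) :
    (x : K) ^ 2 + x + 1 = 0 := by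
  have h3 : (x : K) ^ 3 = 1 := by rw [← Units.val_pow_eq_pow_val, hx, Units.val_one]
  refine mul_left_cancel₀ (sub_ne_zero.mpr (Units.val_eq_one.not.mpr hx1)) ?_
  linear_combination h3

lemma exists_isConj_diagonalGL_of_pow_three_eq_one [CharP K 2] (z : Kˣ) (hz : z ^ 3 = 1)
    (hz1 : z ≠ 1) (A : GL (Fin n) K) (hA : A ^ 3 = 1) :
    ∃ u : Fin n → Kˣ, IsConj A (diagonalGL u) := by
  refine exists_isConj_diagonalGL A fun v _ => ?_
  have h2 : (2 : K) = 0 := CharTwo.two_eq_zero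
  have hz3 : (z : K) ^ 3 = 1 := by rw [← Units.val_pow_eq_pow_val, hz, Units.val_one]
  have hz0 := sq_add_self_add_one_eq_zero hz hz1
  set M : Matrix (Fin n) (Fin n) K := A.val with hM
  have hM3 : M *ᵥ (M *ᵥ (M *ᵥ v)) = v := by
    have : M ^ 3 = 1 := by rw [hM, ← Units.val_pow_eq_pow_val, hA, Units.val_one]
    rw [mulVec_mulVec, mulVec_mulVec, ← pow_two, ← pow_succ, this, one_mulVec]
  have eig (w : Kˣ) (hw : (w : K) ^ 3 = 1) :
      v + (w : K) ^ 2 • M *ᵥ v + (w : K) • M *ᵥ (M *ᵥ v) ∈ Submodule.span K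
        {v : Fin n → K | ∃ z : Kˣ, M *ᵥ v = (z : K) • v} := by
    refine Submodule.subset_span ⟨w, ?_⟩
    simp only [mulVec_add, mulVec_smul, hM3]
    linear_combination (norm := module) -(hw • (M *ᵥ v))
  have key := add_mem (add_mem (eig 1 (by simp)) (eig z hz3))
    (eig (z ^ 2) (by push_cast; linear_combination ((z : K) ^ 3 + 1) * hz3))
  convert key using 1
  push_cast
  linear_combination (norm := module) -(h2 • v) - hz0 • (M *ᵥ v) - hz0 • (M *ᵥ (M *ᵥ v))
    - ((z : K) * hz3) • (M *ᵥ v)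

lemma isConj_diagonalGL_comp (u : Fin n → Kˣ) (σ : Equiv.Perm (Fin n)) :
    IsConj (diagonalGL u) (diagonalGL (u ∘ σ)) := by
  refine IsConj.symm ⟨toUnits ((permMatrixHom (n := Fin n) (R := K)).toHomUnits σ), ?_⟩
  refine Units.ext ?_
  ext i j
  have hperm : (toUnits ((permMatrixHom (n := Fin n) (R := K)).toHomUnits σ) :
      GL (Fin n) K).val i j = if i = σ j then 1 else 0 := by
    change (σ⁻¹).permMatrix K i j = _
    simp only [PEquiv.toMatrix_apply, Equiv.toPEquiv_apply, Option.mem_some_iff,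
      Equiv.Perm.inv_eq_iff_eq]
  rw [Units.val_mul, Units.val_mul, coe_diagonalGL, coe_diagonalGL, mul_diagonal, diagonal_mul]
  erw [hperm]
  split_ifs with h <;> simp [h]

lemma rank_sub_scalar_eq_of_isConj {A B : GL (Fin n) K} (h : IsConj A B) (w : K) :
    ((A : Matrix (Fin n) (Fin n) K) - scalar _ w).rank =
      ((B : Matrix (Fin n) (Fin n) K) - scalar _ w).rank := by
  obtain ⟨c, hc⟩ := h
  have hc' : ((c : GL (Fin n) K) : Matrix (Fin n) (Fin n) K) * A = B * (c : GL (Fin n) K) :=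
    congrArg Units.val hc
  have hdet : IsUnit ((c : GL (Fin n) K) : Matrix (Fin n) (Fin n) K).det :=
    (isUnit_iff_isUnit_det _).mp (Units.isUnit _)
  rw [← rank_mul_eq_right_of_isUnit_det _ _ hdet, mul_sub, hc',
    ← (scalar_commute w (mul_comm w) _).eq, ← sub_mul, rank_mul_eq_left_of_isUnit_det _ _ hdet]

lemma rank_diagonalGL_sub_scalar [DecidableEq K] (u : Fin n → Kˣ) (w : Kˣ) :
    ((diagonalGL u : Matrix (Fin n) (Fin n) K) - scalar _ (w : K)).rank =
      (Finset.univ.filter fun i => u i ≠ w).card := by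
  rw [coe_diagonalGL, scalar_apply, diagonal_sub, Matrix.rank_diagonal, Fintype.card_subtype]
  simp [sub_eq_zero, Units.val_inj]

lemma card_filter_eq_of_isConj [DecidableEq K] {u v : Fin n → Kˣ}
    (h : IsConj (diagonalGL u) (diagonalGL v)) (w : Kˣ) :
    (Finset.univ.filter fun i => u i = w).card = (Finset.univ.filter fun i => v i = w).card := by
  have := rank_sub_scalar_eq_of_isConj h (w : K)
  rw [rank_diagonalGL_sub_scalar, rank_diagonalGL_sub_scalar] at this
  have hu := Finset.card_filter_add_card_filter_not (s := Finset.univ) (fun i => u i = w)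
  have hv := Finset.card_filter_add_card_filter_not (s := Finset.univ) (fun i => v i = w)
  lia

/-- If the products of commuting conjugates of a diagonal matrix meet at most two classes, then
the positions of a fixed value in the products of the diagonal with its rearrangements cannot form
a strictly increasing chain of length three. -/
lemma not_ssubset_chain_of_few_classes [DecidableEq K] {u : Fin n → Kˣ} {X Y : GL (Fin n) K}
    (h : ∀ B C : GL (Fin n) K, IsConj (diagonalGL u) B → IsConj (diagonalGL u) C →
      B * C = C * B → IsConj (B * C) X ∨ IsConj (B * C) Y)
    (w : Kˣ) (σ₁ σ₂ σ₃ : Equiv.Perm (Fin n))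
    (h₁₂ : (Finset.univ.filter fun i => u i * u (σ₁ i) = w) ⊂
      Finset.univ.filter fun i => u i * u (σ₂ i) = w)
    (h₂₃ : (Finset.univ.filter fun i => u i * u (σ₂ i) = w) ⊂
      Finset.univ.filter fun i => u i * u (σ₃ i) = w) : False := by
  have hXY (σ : Equiv.Perm (Fin n)) : IsConj (diagonalGL (u * u ∘ σ)) X ∨
      IsConj (diagonalGL (u * u ∘ σ)) Y := by
    rw [map_mul]
    exact h _ _ (IsConj.refl _) (isConj_diagonalGL_comp u σ)
      (by rw [← map_mul, ← map_mul, mul_comm])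
  have hne (σ τ : Equiv.Perm (Fin n)) (hlt : (Finset.univ.filter fun i => u i * u (σ i) = w) ⊂
      Finset.univ.filter fun i => u i * u (τ i) = w) (Z : GL (Fin n) K)
      (hσ : IsConj (diagonalGL (u * u ∘ σ)) Z) (hτ : IsConj (diagonalGL (u * u ∘ τ)) Z) :
      False :=
    (Finset.card_lt_card hlt).ne (card_filter_eq_of_isConj (hσ.trans hτ.symm) w)
  have h₁ := hXY σ₁
  have h₂ := hXY σ₂
  have h₃ := hXY σ₃
  have h12 := hne _ _ h₁₂
  have h23 := hne _ _ h₂₃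
  have h13 := hne _ _ (h₁₂.trans h₂₃)
  tauto

lemma mul_eq_one_of_pow_three_eq_one {x y : Kˣ} (hx : x ^ 3 = 1) (hy : y ^ 3 = 1) (hx1 : x ≠ 1)
    (hy1 : y ≠ 1) (hxy : x ≠ y) : x * y = 1 := by
  have hsum : (x : K) + y + 1 = 0 := by
    refine mul_left_cancel₀ (sub_ne_zero.mpr (Units.val_inj.not.mpr hxy)) ?_
    linear_combination sq_add_self_add_one_eq_zero hx hx1 - sq_add_self_add_one_eq_zero hy hy1
  ext
  push_cast
  linear_combination (x : K) * hsum - sq_add_self_add_one_eq_zero hx hx1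

lemma eq_of_mul_self_eq_of_pow_three_eq_one {G : Type*} [Group G] {x y : G} (hx : x ^ 3 = 1)
    (hy : y ^ 3 = 1) (h : x * x = y * y) : x = y := by
  calc x = (x * x) * (x * x) := by rw [← pow_two, ← pow_two, ← pow_mul, pow_succ, hx, one_mul]
    _ = (y * y) * (y * y) := by rw [h]
    _ = y := by rw [← pow_two, ← pow_two, ← pow_mul, pow_succ, hy, one_mul]

/-- In the few-classes situation, a diagonal of cube roots of unity with at least two ones has at
most one entry different from one. -/
lemma eq_of_ne_one_of_few_classes {u : Fin n → Kˣ} (hu : ∀ i, u i ^ 3 = 1)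
    {X Y : GL (Fin n) K}
    (h : ∀ B C : GL (Fin n) K, IsConj (diagonalGL u) B → IsConj (diagonalGL u) C →
      B * C = C * B → IsConj (B * C) X ∨ IsConj (B * C) Y)
    {i₁ i₂ j₁ j₂ : Fin n} (hi : i₁ ≠ i₂) (hi₁ : u i₁ = 1) (hi₂ : u i₂ = 1)
    (hj₁ : u j₁ ≠ 1) (hj₂ : u j₂ ≠ 1) : j₁ = j₂ := by
  classical
  by_contra hj
  have hsq (i k : Fin n) : u i * u i = u k * u k ↔ u i = u k :=
    ⟨eq_of_mul_self_eq_of_pow_three_eq_one (hu i) (hu k), fun h => by rw [h]⟩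
  have hssub (p q : Fin n → Prop) [DecidablePred p] [DecidablePred q] (hpq : ∀ k, p k → q k)
      (k : Fin n) (hq : q k) (hp : ¬ p k) :
      Finset.univ.filter p ⊂ Finset.univ.filter q :=
    (Finset.ssubset_iff_of_subset (Finset.monotone_filter_right _ fun k _ => hpq k)).mpr
      ⟨k, by simpa using hq, by simpa using hp⟩
  by_cases huj : u j₁ = u j₂
  · have hne : u j₁ * u j₁ ≠ u j₁ := by simpa using hj₁
    refine not_ssubset_chain_of_few_classes h (u j₁ * u j₁)
      (Equiv.swap i₁ j₁ * Equiv.swap i₂ j₂) (Equiv.swap i₁ j₁) 1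
      (hssub _ _ (fun k hk => ?_) j₂ ?_ ?_) (hssub _ _ (fun k hk => ?_) j₁ ?_ ?_) <;>
    · clear h hssub
      grind [Equiv.Perm.mul_apply, Equiv.Perm.one_apply]
  · have huj' := mul_eq_one_of_pow_three_eq_one (hu j₁) (hu j₂) hj₁ hj₂ huj
    refine not_ssubset_chain_of_few_classes h 1 (Equiv.swap i₁ j₁) 1 (Equiv.swap j₁ j₂)
      (hssub _ _ (fun k hk => ?_) i₁ ?_ ?_) (hssub _ _ (fun k hk => ?_) j₁ ?_ ?_) <;>
    · clear h hssub
      grind [Equiv.Perm.one_apply]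

end

theorem few_classes_implies_conjugate_to_one_root_diagonal
    (K : Type*) [Field K] [CharP K 2] (ξ : K) (hξ : ξ ^ 3 = 1) (hξ1 : ξ ≠ 1)
    (n : ℕ) (hn : 4 ≤ n) (A : Matrix.GeneralLinearGroup (Fin n) K)
    (hA3 : A ^ 3 = 1) (hA1 : A ≠ 1)
    (hrank : ((A : Matrix (Fin n) (Fin n) K) - 1).rank ≤ n - 2)
    (hclasses : ∃ X Y : Matrix.GeneralLinearGroup (Fin n) K,
      ∀ B C : Matrix.GeneralLinearGroup (Fin n) K,
        IsConj A B → IsConj A C → B * C = C * B →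
          IsConj (B * C) X ∨ IsConj (B * C) Y) :
    ∃ U : Matrix.GeneralLinearGroup (Fin n) K,
      ((U * A * U⁻¹ : Matrix.GeneralLinearGroup (Fin n) K) :
          Matrix (Fin n) (Fin n) K) =
        Matrix.diagonal (fun j : Fin n => if (j : ℕ) = 0 then ξ else 1) ∨
      ((U * A * U⁻¹ : Matrix.GeneralLinearGroup (Fin n) K) :
          Matrix (Fin n) (Fin n) K) =
        Matrix.diagonal (fun j : Fin n => if (j : ℕ) = 0 then ξ ^ 2 else 1) := by
  classical
  let z : Kˣ := Units.ofPowEqOne ξ 3 hξ three_ne_zero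
  have hzξ : (z : K) = ξ := rfl
  have hz : z ^ 3 = 1 := Units.pow_ofPowEqOne hξ three_ne_zero
  have hz1 : z ≠ 1 := fun h => hξ1 (by rw [← hzξ, h, Units.val_one])
  obtain ⟨u, hAu⟩ := exists_isConj_diagonalGL_of_pow_three_eq_one z hz hz1 A hA3
  have hu (i : Fin n) : u i ^ 3 = 1 := by
    have h : diagonalGL (u ^ 3) = 1 := by
      have hpow := hAu.pow 3
      rw [hA3, isConj_one_right] at hpow
      rw [map_pow, hpow]
    have hi : (diagonalGL (u ^ 3) : Matrix (Fin n) (Fin n) K) i i = 1 := by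
      rw [h, Units.val_one, one_apply_eq]
    rw [coe_diagonalGL, diagonal_apply_eq] at hi
    exact Units.ext hi
  have hcard : 2 ≤ (Finset.univ.filter fun i => u i = 1).card := by
    have h := rank_sub_scalar_eq_of_isConj hAu 1
    rw [map_one] at h
    have h' := rank_diagonalGL_sub_scalar u 1
    rw [Units.val_one, map_one] at h'
    have := Finset.card_filter_add_card_filter_not (s := Finset.univ) (fun i => u i = 1)
    simp only [Finset.card_univ, Fintype.card_fin] at this
    lia
  obtain ⟨i₁, hi₁, i₂, hi₂, hi⟩ := Finset.one_lt_card.mp hcard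
  simp only [Finset.mem_filter, Finset.mem_univ, true_and] at hi₁ hi₂
  obtain ⟨X, Y, hXY⟩ := hclasses
  have huniq {j₁ j₂ : Fin n} (h₁ : u j₁ ≠ 1) (h₂ : u j₂ ≠ 1) : j₁ = j₂ :=
    eq_of_ne_one_of_few_classes hu
      (fun B C hB hC hBC => hXY B C (hAu.trans hB) (hAu.trans hC) hBC) hi hi₁ hi₂ h₁ h₂
  obtain ⟨j, hj⟩ : ∃ j, u j ≠ 1 := by
    by_contra! h
    rw [show u = 1 from funext h, map_one, isConj_one_left] at hAu
    exact hA1 hAu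
  let o : Fin n := ⟨0, by lia⟩
  obtain ⟨U, hU⟩ := isConj_iff.mp (hAu.trans (isConj_diagonalGL_comp u (Equiv.swap o j)))
  have hdiag (k : Fin n) : (u ∘ Equiv.swap o j) k = if (k : ℕ) = 0 then u j else 1 := by
    have hk : (k : ℕ) = 0 ↔ k = o := by simp [o, Fin.ext_iff]
    simp only [hk, Function.comp_apply, Equiv.swap_apply_def]
    grind
  have hroot : u j = z ∨ u j = z ^ 2 := by
    by_cases h : u j = z
    · exact .inl h
    · refine .inr (mul_right_cancel (b := z) ?_)
      rw [mul_eq_one_of_pow_three_eq_one (hu j) hz hj hz1 h, ← pow_succ, hz]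
  refine ⟨U, hroot.imp (fun h => ?_) fun h => ?_⟩ <;>
  · rw [hU, coe_diagonalGL]
    congr 1
    ext k
    rw [hdiag k, h]
    split_ifs <;> simp [hzξ]
end

section
/- Let K be a field of characteristic 2 in which 1 is the only cube root of unity (x³ = 1 implies x = 1), and let A₁, …, A_m ∈ GL_n(K) be pairwise commuting matrices with A_i³ = 1 for every i. Then there exists P ∈ GL_n(K) such that for every i the matrix M_i = P A_i P⁻¹ is block-diagonal with 2×2 diagonal blocks in rows and columns {2j−1, 2j} (for 1 ≤ j ≤ ⌊n/2⌋), each such block equal to T, T², or I₂, all entries of M_i outside these blocks being 0, and, when n is odd, with last diagonal entry (M_i)_{n,n} = 1. -/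
/-- The 2×2 matrix `T` with rows `(1,1)` and `(1,0)`. -/
def Tmat (K : Type*) [Field K] : Matrix (Fin 2) (Fin 2) K := !![1, 1; 1, 0]

open Polynomial in
theorem irreducible_X_sq_add_X_add_one {K : Type*} [Field K] [CharP K 2]
    (hcube : ∀ x : K, x ^ 3 = 1 → x = 1) : Irreducible (X ^ 2 + X + 1 : K[X]) := by
  have hdeg : (X ^ 2 + X + 1 : K[X]).natDegree = 2 := by compute_degree!
  refine irreducible_of_degree_le_three_of_not_isRoot (by simp [hdeg]) fun x hx => ?_
  have h : x ^ 2 + x + 1 = 0 := by simpa [IsRoot] using hx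
  have h2 : (2 : K) = 0 := CharTwo.two_eq_zero
  have h1 : x = 1 := hcube x (by linear_combination (x - 1) * h)
  subst h1
  exact one_ne_zero (α := K) (by linear_combination h - h2)

open Polynomial in
/-- An endomorphism annihilated by the irreducible polynomial `X ^ 2 + X + 1` makes the space a
vector space over a quadratic extension, hence has a basis of pairs `v, s v`. -/
theorem exists_basis_pairs {K V : Type*} [Field K] [CharP K 2]
    (hcube : ∀ x : K, x ^ 3 = 1 → x = 1) [AddCommGroup V] [Module K V] [FiniteDimensional K V]
    (s : Module.End K V) (hs : s ^ 2 + s + 1 = 0) :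
    ∃ (k : ℕ) (b : Module.Basis (Fin k × Fin 2) K V), ∀ j, b (j, 1) = s (b (j, 0)) := by
  set f : K[X] := X ^ 2 + X + 1 with hf
  have hdeg : f.natDegree = 2 := by rw [hf]; compute_degree!
  have : Fact (Irreducible f) := ⟨irreducible_X_sq_add_X_add_one hcube⟩
  let φ : AdjoinRoot f →ₐ[K] Module.End K V :=
    Ideal.Quotient.liftₐ (Ideal.span {f}) (aeval s) (by
      intro a ha
      obtain ⟨c, rfl⟩ := Ideal.mem_span_singleton.1 ha
      simp [hf, hs])
  have hroot : φ (AdjoinRoot.root f) = s := by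
    change φ (AdjoinRoot.mk f X) = s
    exact (aeval_X s)
  let : Module (AdjoinRoot f) V := Module.compHom V φ.toRingHom
  have hsmul : ∀ (x : AdjoinRoot f) (v : V), x • v = φ x v := fun _ _ => rfl
  have : IsScalarTower K (AdjoinRoot f) V :=
    ⟨fun x y z => by simp [hsmul]⟩
  have : Module.Finite (AdjoinRoot f) V := Module.Finite.of_restrictScalars_finite K _ _
  have hf0 : f ≠ 0 := (Fact.out : Irreducible f).ne_zero
  let pb := AdjoinRoot.powerBasis hf0
  have hdim : pb.dim = 2 := hdeg
  refine ⟨_, (pb.basis.reindex (finCongr hdim)).smulTower' (Module.finBasis (AdjoinRoot f) V),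
    fun j => ?_⟩
  have hgen : pb.gen = AdjoinRoot.root f := rfl
  simp [Module.Basis.smulTower'_apply, hsmul, hgen, hroot]

theorem eq_one_or_of_sq_add_self {R : Type*} [Ring R] (h2 : (2 : R) = 0) {t : R} (ht : t ^ 3 = 1)
    (h : t ^ 2 + t = 0 ∨ t ^ 2 + t = 1) : t = 1 ∨ t ^ 2 + t + 1 = 0 := by
  rcases h with h | h
  · left
    have key : t - t ^ 3 = (1 - t) * (t ^ 2 + t) := by noncomm_ring
    rw [h, mul_zero, ht] at key
    exact sub_eq_zero.1 key
  · right
    rw [h, one_add_one_eq_two, h2]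

theorem isIdempotentElem_sq_add_self {R : Type*} [Ring R] (h2 : (2 : R) = 0) {t : R}
    (ht : t ^ 3 = 1) : IsIdempotentElem (t ^ 2 + t) := by
  have key : (t ^ 2 + t) * (t ^ 2 + t) = t ^ 3 * t + 2 * t ^ 3 + t ^ 2 := by noncomm_ring
  rw [IsIdempotentElem, key, ht, h2, one_mul, zero_mul, add_zero, add_comm]

theorem pow_three_eq_one_of_sq_add_self_add_one {R : Type*} [Ring R] {s : R}
    (hs : s ^ 2 + s + 1 = 0) : s ^ 3 = 1 := by
  have key : s ^ 3 - 1 = (s - 1) * (s ^ 2 + s + 1) := by noncomm_ring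
  rw [hs, mul_zero] at key
  exact sub_eq_zero.1 key

theorem one_eq_zero_of_sq_add_self_add_one {R : Type*} [Ring R] (h2 : (2 : R) = 0) {s t : R}
    (hst : Commute t s) (hs : s ^ 2 + s + 1 = 0) (h0 : t ^ 2 + t + 1 = 0)
    (h1 : (t * s) ^ 2 + t * s + 1 = 0) (h3 : (t * s ^ 2) ^ 2 + t * s ^ 2 + 1 = 0) :
    (1 : R) = 0 := by
  rw [hst.mul_pow] at h1
  rw [(hst.pow_right 2).mul_pow] at h3
  have key : (3 : ℕ) • (1 : R) = (t ^ 2 + t + 1) + (t ^ 2 * s ^ 2 + t * s + 1)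
      + (t ^ 2 * (s ^ 2) ^ 2 + t * s ^ 2 + 1)
      - t ^ 2 * ((s ^ 2 - s + 1) * (s ^ 2 + s + 1)) - t * (s ^ 2 + s + 1) := by noncomm_ring
  have h3' : (3 : ℕ) • (1 : R) = 1 + 2 := by norm_num
  rwa [h0, h1, h3, hs, h3', h2, mul_zero, mul_zero, mul_zero, sub_zero, sub_zero, add_zero,
    add_zero, add_zero] at key

/-- On the pair `x, y` the endomorphism `f` acts by one of the matrices `T`, `T ^ 2`, `1`. -/
def IsBlockPair {K V : Type*} [Field K] [AddCommGroup V] [Module K V] (f : Module.End K V)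
    (x y : V) : Prop :=
  (f x = x + y ∧ f y = x) ∨ (f x = y ∧ f y = x + y) ∨ (f x = x ∧ f y = y)

/-- The family `a` acts by blocks `T`, `T ^ 2`, `1` on the pairs of a common basis, and fixes the
unpaired basis vectors. -/
def HasBlockBasis {K V ι : Type*} [Field K] [AddCommGroup V] [Module K V]
    (a : ι → Module.End K V) : Prop :=
  ∃ (κ τ : Type) (_ : Fintype κ) (_ : Fintype τ) (b : Module.Basis (κ × Fin 2 ⊕ τ) K V),
    ∀ i, (∀ j, IsBlockPair (a i) (b (Sum.inl (j, 0))) (b (Sum.inl (j, 1)))) ∧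
      ∀ t, a i (b (Sum.inr t)) = b (Sum.inr t)

section

variable {K V ι : Type*} [Field K] [AddCommGroup V] [Module K V]

theorem IsBlockPair.of_restrict {W : Submodule K V} {f : Module.End K V}
    {hf : ∀ x ∈ W, f x ∈ W} {x y : W} (h : IsBlockPair (f.restrict hf) x y) :
    IsBlockPair f (x : V) (y : V) := by
  simpa [IsBlockPair, Subtype.ext_iff] using h

theorem HasBlockBasis.of_isCompl {a : ι → Module.End K V} {U W : Submodule K V} (h : IsCompl U W)
    {hU : ∀ i, ∀ x ∈ U, a i x ∈ U} {hW : ∀ i, ∀ x ∈ W, a i x ∈ W}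
    (bU : HasBlockBasis fun i => (a i).restrict (hU i))
    (bW : HasBlockBasis fun i => (a i).restrict (hW i)) : HasBlockBasis a := by
  obtain ⟨κ, τ, _, _, b, hb⟩ := bU
  obtain ⟨κ', τ', _, _, b', hb'⟩ := bW
  let e : (κ × Fin 2 ⊕ τ) ⊕ (κ' × Fin 2 ⊕ τ') ≃ (κ ⊕ κ') × Fin 2 ⊕ (τ ⊕ τ') :=
    (Equiv.sumSumSumComm _ _ _ _).trans
      (Equiv.sumCongr (Equiv.sumProdDistrib _ _ _).symm (Equiv.refl _))
  refine ⟨κ ⊕ κ', τ ⊕ τ', inferInstance, inferInstance,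
    ((b.prod b').map (Submodule.prodEquivOfIsCompl U W h)).reindex e, fun i => ⟨?_, ?_⟩⟩
  · rintro (j | j)
    · simpa [e] using ((hb i).1 j).of_restrict
    · simpa [e] using ((hb' i).1 j).of_restrict
  · rintro (t | t)
    · simpa [e, Subtype.ext_iff] using (hb i).2 t
    · simpa [e, Subtype.ext_iff] using (hb' i).2 t

theorem HasBlockBasis.of_forall_eq_one [FiniteDimensional K V] {a : ι → Module.End K V}
    (h : ∀ i, a i = 1) : HasBlockBasis a :=
  ⟨Fin 0, Fin (Module.finrank K V), inferInstance, inferInstance,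
    (Module.finBasis K V).reindex (Equiv.emptySum _ _).symm, fun i => by simp [h]⟩

theorem HasBlockBasis.of_forall_mem [CharP K 2] (hcube : ∀ x : K, x ^ 3 = 1 → x = 1)
    [FiniteDimensional K V] {a : ι → Module.End K V} {s : Module.End K V}
    (hs : s ^ 2 + s + 1 = 0) (h : ∀ i, a i = 1 ∨ a i = s ∨ a i = s ^ 2) : HasBlockBasis a := by
  obtain ⟨k, b, hb⟩ := exists_basis_pairs hcube s hs
  have h2 (v : V) : v + v = 0 := by
    rw [← two_smul K v, CharTwo.two_eq_zero, zero_smul]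
  have hss (v : V) : s (s v) = v + s v := by
    have := LinearMap.congr_fun hs v
    simp only [pow_two, LinearMap.add_apply, Module.End.mul_apply, Module.End.one_apply,
      LinearMap.zero_apply] at this
    calc s (s v) = (s (s v) + s v + v) - (s v + s v) - (v + v) + (v + s v) := by abel
      _ = v + s v := by rw [this, h2, h2, sub_zero, sub_zero, zero_add]
  refine ⟨Fin k, Fin 0, inferInstance, inferInstance,
    b.reindex (Equiv.sumEmpty _ _).symm, fun i => ⟨fun j => ?_, fun t => t.elim0⟩⟩
  have h3 (v w : V) : v + (w + v) = w := by rw [add_left_comm, h2, add_zero]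
  rcases h i with h | h | h <;>
    simp [IsBlockPair, h, hb, hss, pow_two, h3]

theorem hasBlockBasis_of_commute [CharP K 2] (hcube : ∀ x : K, x ^ 3 = 1 → x = 1)
    [FiniteDimensional K V] (a : ι → Module.End K V) (hcomm : ∀ i j, Commute (a i) (a j))
    (hord : ∀ i, a i ^ 3 = 1) : HasBlockBasis a := by
  induction hn : Module.finrank K V using Nat.strong_induction_on generalizing V with
  | _ n ih =>
  subst hn
  by_cases hp : ∃ p : Module.End K V, IsIdempotentElem p ∧ (∀ i, Commute p (a i)) ∧ p ≠ 0 ∧ p ≠ 1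
  · obtain ⟨p, hp, hpa, hp0, hp1⟩ := hp
    have hpa' (i x) : p (a i x) = a i (p x) := LinearMap.congr_fun (hpa i).eq x
    have hU (i) : ∀ x ∈ LinearMap.range p, a i x ∈ LinearMap.range p := by
      rintro _ ⟨x, rfl⟩
      exact ⟨a i x, hpa' i x⟩
    have hW (i) : ∀ x ∈ LinearMap.ker p, a i x ∈ LinearMap.ker p := fun x hx => by
      rw [LinearMap.mem_ker] at hx ⊢
      rw [hpa', hx, map_zero]
    have hc := LinearMap.IsIdempotentElem.isCompl hp
    have restrict (W : Submodule K V) (hW : ∀ i, ∀ x ∈ W, a i x ∈ W) (hW' : W ≠ ⊤) :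
        HasBlockBasis fun i => (a i).restrict (hW i) := by
      refine ih _ (Submodule.finrank_lt hW') _ (fun i j => ?_) (fun i => ?_) rfl
      · ext x
        simpa using LinearMap.congr_fun (hcomm i j).eq (x : V)
      · ext x
        simpa [pow_succ] using LinearMap.congr_fun (hord i) (x : V)
    refine .of_isCompl hc (restrict _ hU fun h => hp1 ?_) (restrict _ hW fun h => hp0 ?_)
    · ext x
      obtain ⟨y, rfl⟩ : x ∈ LinearMap.range p := h ▸ Submodule.mem_top
      exact LinearMap.congr_fun hp y
    · exact LinearMap.ker_eq_top.1 h
  · have h2 : (2 : Module.End K V) = 0 := by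
      ext v
      rw [← one_add_one_eq_two, LinearMap.add_apply, Module.End.one_apply, ← two_smul K v,
        CharTwo.two_eq_zero, zero_smul, LinearMap.zero_apply]
    have dich (t : Module.End K V) (ht : t ^ 3 = 1) (hta : ∀ i, Commute t (a i)) :
        t = 1 ∨ t ^ 2 + t + 1 = 0 := by
      refine eq_one_or_of_sq_add_self h2 ht ?_
      by_contra! hne
      exact hp ⟨_, isIdempotentElem_sq_add_self h2 ht,
        fun i => ((hta i).pow_left 2).add_left (hta i), hne⟩
    by_cases h1 : ∀ i, a i = 1
    · exact .of_forall_eq_one h1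
    push Not at h1
    obtain ⟨i₀, hi₀⟩ := h1
    have hs := (dich _ (hord i₀) (hcomm i₀)).resolve_left hi₀
    refine .of_forall_mem hcube hs fun i => ?_
    have hi := hcomm i i₀
    rcases dich _ (hord i) (hcomm i) with h | h
    · exact .inl h
    rcases dich (a i * a i₀) (by rw [hi.mul_pow, hord, hord, one_mul])
      (fun j => (hcomm i j).mul_left (hcomm i₀ j)) with h' | h'
    · right; right
      calc a i = a i * a i₀ ^ 3 := by rw [hord, mul_one]
        _ = a i * a i₀ * a i₀ ^ 2 := by noncomm_ring
        _ = _ := by rw [h', one_mul]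
    rcases dich (a i * a i₀ ^ 2) (by
        rw [(hi.pow_right 2).mul_pow, hord, ← pow_mul, pow_mul', hord, one_pow, one_mul])
      (fun j => (hcomm i j).mul_left ((hcomm i₀ j).pow_left 2)) with h'' | h''
    · right; left
      calc a i = a i * a i₀ ^ 3 := by rw [hord, mul_one]
        _ = a i * a i₀ ^ 2 * a i₀ := by noncomm_ring
        _ = _ := by rw [h'', one_mul]
    have h10 := one_eq_zero_of_sq_add_self_add_one h2 hi hs h h' h''
    exact absurd (by rw [← mul_one (a i₀), h10, mul_zero]) hi₀

/-- The pairs of a block basis can be listed first, followed by the fixed vectors. -/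
theorem HasBlockBasis.exists_basis_fin {a : ι → Module.End K V} (h : HasBlockBasis a) {n : ℕ}
    (hn : Module.finrank K V = n) :
    ∃ (k : ℕ) (_ : 2 * k ≤ n) (b : Module.Basis (Fin n) K V), ∀ i,
      (∀ j, ∀ hj : j < k, IsBlockPair (a i) (b ⟨2 * j, by omega⟩) (b ⟨2 * j + 1, by omega⟩)) ∧
      ∀ q : Fin n, 2 * k ≤ q → a i (b q) = b q := by
  obtain ⟨κ, τ, _, _, b, hb⟩ := h
  have hcard : Fintype.card κ * 2 + Fintype.card τ = n := by
    rw [← hn, Module.finrank_eq_card_basis b]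
    simp
  let e : κ × Fin 2 ⊕ τ ≃ Fin n :=
    (Equiv.sumCongr (((Fintype.equivFin κ).prodCongr (Equiv.refl _)).trans finProdFinEquiv)
      (Fintype.equivFin τ)).trans (finSumFinEquiv.trans (finCongr hcard))
  have he (x) (q : Fin n) (hq : e x = q) : b.reindex e q = b x := by simp [← hq]
  refine ⟨Fintype.card κ, by omega, b.reindex e, fun i => ⟨fun j hj => ?_, fun q hq => ?_⟩⟩
  · rw [he (Sum.inl ((Fintype.equivFin κ).symm ⟨j, hj⟩, 0)),
      he (Sum.inl ((Fintype.equivFin κ).symm ⟨j, hj⟩, 1))]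
    · exact (hb i).1 _
    · ext
      simp [e, add_comm]
    · ext
      simp [e]
  · rw [he (Sum.inr ((Fintype.equivFin τ).symm ⟨q - 2 * Fintype.card κ, by omega⟩))]
    · exact (hb i).2 _
    · ext
      simp [e]
      omega

end

theorem Module.Basis.exists_conj_apply_eq_repr {K : Type*} [Field K] {n : ℕ}
    (b : Module.Basis (Fin n) K (Fin n → K)) :
    ∃ P : Matrix.GeneralLinearGroup (Fin n) K, ∀ (A : Matrix.GeneralLinearGroup (Fin n) K) p q,
      ((P * A * P⁻¹ : Matrix.GeneralLinearGroup (Fin n) K) : Matrix (Fin n) (Fin n) K) p q =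
        b.repr (Matrix.toLin' (A : Matrix (Fin n) (Fin n) K) (b q)) p := by
  refine ⟨⟨b.toMatrix (Pi.basisFun K _), (Pi.basisFun K _).toMatrix b,
    b.toMatrix_mul_toMatrix_flip _, Module.Basis.toMatrix_mul_toMatrix_flip _ _⟩, fun A p q => ?_⟩
  have h := basis_toMatrix_mul_linearMap_toMatrix_mul_basis_toMatrix
    b (Pi.basisFun K (Fin n)) b (Pi.basisFun K (Fin n)) (Matrix.toLin' (A : Matrix _ _ K))
  rw [LinearMap.toMatrix_eq_toMatrix', LinearMap.toMatrix'_toLin'] at h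
  exact (congr_fun₂ h p q).trans (LinearMap.toMatrix_apply _ _ _ _ _)

theorem commuting_cube_roots_simultaneous_block_diagonalization
    (K : Type*) [Field K] [CharP K 2]
    (hcube : ∀ x : K, x ^ 3 = 1 → x = 1)
    (n m : ℕ) (A : Fin m → Matrix.GeneralLinearGroup (Fin n) K)
    (hcomm : ∀ i j : Fin m, A i * A j = A j * A i)
    (hord : ∀ i : Fin m, A i ^ 3 = 1) :
    ∃ P : Matrix.GeneralLinearGroup (Fin n) K, ∀ i : Fin m,
      -- the 2×2 diagonal blocks are `T`, `T²` or `I₂`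
      (∀ j : ℕ, ∀ hj : 2 * j + 1 < n,
        (Matrix.of fun p q : Fin 2 =>
            ((P * A i * P⁻¹ : Matrix.GeneralLinearGroup (Fin n) K) :
              Matrix (Fin n) (Fin n) K)
              ⟨2 * j + (p : ℕ), by have := p.isLt; omega⟩
              ⟨2 * j + (q : ℕ), by have := q.isLt; omega⟩) = Tmat K ∨
        (Matrix.of fun p q : Fin 2 =>
            ((P * A i * P⁻¹ : Matrix.GeneralLinearGroup (Fin n) K) :
              Matrix (Fin n) (Fin n) K)
              ⟨2 * j + (p : ℕ), by have := p.isLt; omega⟩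
              ⟨2 * j + (q : ℕ), by have := q.isLt; omega⟩) = (Tmat K) ^ 2 ∨
        (Matrix.of fun p q : Fin 2 =>
            ((P * A i * P⁻¹ : Matrix.GeneralLinearGroup (Fin n) K) :
              Matrix (Fin n) (Fin n) K)
              ⟨2 * j + (p : ℕ), by have := p.isLt; omega⟩
              ⟨2 * j + (q : ℕ), by have := q.isLt; omega⟩) = 1) ∧
      -- all entries outside the 2×2 diagonal blocks vanish
      (∀ p q : Fin n, (p : ℕ) / 2 ≠ (q : ℕ) / 2 →
        ((P * A i * P⁻¹ : Matrix.GeneralLinearGroup (Fin n) K) :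
          Matrix (Fin n) (Fin n) K) p q = 0) ∧
      -- if `n` is odd, the last diagonal entry is `1`
      (∀ hodd : n % 2 = 1,
        ((P * A i * P⁻¹ : Matrix.GeneralLinearGroup (Fin n) K) :
          Matrix (Fin n) (Fin n) K) ⟨n - 1, by omega⟩ ⟨n - 1, by omega⟩ = 1) := by
  let a (i : Fin m) : Module.End K (Fin n → K) := Matrix.toLin' (A i : Matrix (Fin n) (Fin n) K)
  have ha : HasBlockBasis a := by
    refine hasBlockBasis_of_commute hcube a (fun i j => ?_) fun i => ?_
    · simp only [a, Commute, SemiconjBy, Module.End.mul_eq_comp, ← Matrix.toLin'_mul,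
        ← Units.val_mul, hcomm i j]
    · simp only [a, ← Matrix.toLin'_pow, ← Units.val_pow_eq_pow_val, hord, Units.val_one,
        Matrix.toLin'_one]
      rfl
  obtain ⟨k, hk, b, hb⟩ := ha.exists_basis_fin (Module.finrank_fin_fun K)
  obtain ⟨P, hP⟩ := b.exists_conj_apply_eq_repr
  refine ⟨P, fun i => ?_⟩
  obtain ⟨hpair, hfix⟩ := hb i
  have hpair' (j : ℕ) (hj : 2 * j + 1 < n) :
      IsBlockPair (a i) (b ⟨2 * j, by omega⟩) (b ⟨2 * j + 1, hj⟩) := by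
    by_cases hjk : j < k
    · exact hpair j hjk
    · exact .inr (.inr ⟨hfix _ (by simp; omega), hfix _ (by simp; omega)⟩)
  simp only [hP]
  change _ ∧ (∀ p q : Fin n, _ → b.repr (a i (b q)) p = 0) ∧
    ∀ _, b.repr (a i (b _)) _ = 1
  refine ⟨fun j hj => ?_, fun p q hpq => ?_, fun hodd => ?_⟩
  · change (Matrix.of fun p q : Fin 2 => b.repr (a i (b _)) _) = _ ∨
      (Matrix.of fun p q : Fin 2 => b.repr (a i (b _)) _) = _ ∨
      (Matrix.of fun p q : Fin 2 => b.repr (a i (b _)) _) = _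
    refine (hpair' j hj).imp (fun h => ?_) (Or.imp (fun h => ?_) fun h => ?_) <;>
    · ext p q
      fin_cases p <;> fin_cases q <;>
        simp [h.1, h.2, Tmat, pow_two, Matrix.mul_apply, CharTwo.add_self_eq_zero]
  · by_cases hq : 2 * k ≤ q
    · rw [hfix q hq, b.repr_self, Finsupp.single_eq_of_ne]
      rintro rfl
      exact hpq rfl
    · have hqj : q = ⟨2 * (q / 2), by omega⟩ ∨ q = ⟨2 * (q / 2) + 1, by omega⟩ := by
        simp only [Fin.ext_iff]; omega
      have h0 : (⟨2 * (q / 2), by omega⟩ : Fin n) ≠ p := fun h => by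
        have := congr_arg Fin.val h; simp at this; omega
      have h1 : (⟨2 * (q / 2) + 1, by omega⟩ : Fin n) ≠ p := fun h => by
        have := congr_arg Fin.val h; simp at this; omega
      rcases hqj with hqj | hqj <;> rw [hqj] <;>
        rcases hpair (q / 2) (by omega) with h | h | h <;>
        simp [h.1, h.2, h0, h1]
  · rw [hfix _ (by simp; omega), b.repr_self, Finsupp.single_eq_same]
end

section
/- Let K be a field of characteristic 2 in which 1 is the only cube root of unity, let k ≥ 2 and n ≥ 4k, and let D_k ∈ GL_n(K) be the block-diagonal matrix consisting of k consecutive 2×2 blocks equal to T followed by the identity block I_{n−2k}. Then there exist four matrices M₁, M₂, M₃, M₄, pairwise non-conjugate in GL_n(K), such that each M_r has the form M_r = A_r B_r where A_r and B_r are each conjugate to D_k in GL_n(K) and A_r B_r = B_r A_r. -/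
/-- The block-diagonal `n × n` matrix `D_k = diag(T, …, T, 1, …, 1)` consisting of
`k` consecutive `2×2` blocks equal to `T = !![1,1;1,0]` followed by an identity block. -/
def Dmat (K : Type*) [Field K] (n k : ℕ) : Matrix (Fin n) (Fin n) K :=
  Matrix.of fun p q =>
    if (p : ℕ) < 2 * k ∧ (q : ℕ) < 2 * k then
      (if (p : ℕ) / 2 = (q : ℕ) / 2 then
        (if (p : ℕ) % 2 = 1 ∧ (q : ℕ) % 2 = 1 then 0 else 1)
      else 0)
    else (if p = q then 1 else 0)

open Matrix

section BlockSum

variable {K ι ρ ν : Type*} [Field K] [DecidableEq ι] [DecidableEq ρ]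

/-- The block permutation and the permutation inside the blocks, seen on `ν`. -/
def blockPerm (e : (Fin 2 × ι) ⊕ ρ ≃ ν) (σ : Equiv.Perm ι) (τ : Equiv.Perm (Fin 2)) :
    Equiv.Perm ν :=
  e.permCongr ((τ.prodCongr σ).sumCongr (Equiv.refl ρ))

theorem reindex_blockSum_submatrix (e : (Fin 2 × ι) ⊕ ρ ≃ ν) (σ : Equiv.Perm ι)
    (τ : Equiv.Perm (Fin 2)) (f : ι → Matrix (Fin 2) (Fin 2) K) :
    (reindex e e (fromBlocks (blockDiagonal f) 0 0 1)).submatrix (blockPerm e σ τ)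
      (blockPerm e σ τ) =
    reindex e e
      (fromBlocks (blockDiagonal fun i => (f (σ i)).submatrix τ τ) 0 0 1) := by
  ext p q
  obtain ⟨p, rfl⟩ := e.surjective p
  obtain ⟨q, rfl⟩ := e.surjective q
  rcases p with ⟨a, i⟩ | p <;> rcases q with ⟨b, j⟩ | q <;>
    simp [blockPerm, blockDiagonal_apply]

variable [Fintype ι] [Fintype ρ] [Fintype ν] [DecidableEq ν]

/-- The block sum of a family of `2 × 2` matrices and an identity block, with rows and columns
reindexed along `e`. -/
def blockSumHom (e : (Fin 2 × ι) ⊕ ρ ≃ ν) :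
    (ι → Matrix (Fin 2) (Fin 2) K) →* Matrix ν ν K where
  toFun f := reindex e e (fromBlocks (blockDiagonal f) 0 0 1)
  map_one' := by simp
  map_mul' f g := by
    simp [Pi.mul_def, submatrix_mul_equiv, fromBlocks_multiply, blockDiagonal_mul]

theorem isConj_of_coe_eq_submatrix {A B : GL ν K} (τ : Equiv.Perm ν)
    (h : (B : Matrix ν ν K) = (A : Matrix ν ν K).submatrix τ τ) : IsConj A B := by
  have hP : IsUnit (τ.permMatrix K) := by
    rw [isUnit_iff_isUnit_det, det_permutation]
    exact (Equiv.Perm.sign τ).isUnit.map (Int.castRingHom K)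
  obtain ⟨P, hP⟩ := hP
  refine isConj_iff.mpr ⟨P, mul_inv_eq_of_eq_mul (Units.ext ?_)⟩
  change (P : Matrix ν ν K) * A = B * P
  rw [hP, h, Equiv.Perm.permMatrix, PEquiv.toMatrix_toPEquiv_mul, PEquiv.mul_toMatrix_toPEquiv]
  ext i j
  simp

theorem rank_sub_one_eq_of_isConj {A B : GL ν K} (h : IsConj A B) :
    ((A : Matrix ν ν K) - 1).rank = ((B : Matrix ν ν K) - 1).rank := by
  obtain ⟨c, hc⟩ := isConj_iff.mp h
  have hc' : (c : Matrix ν ν K) * A = B * c := congrArg Units.val (mul_inv_eq_iff_eq_mul.mp hc)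
  have hdet : IsUnit (c : Matrix ν ν K).det := (isUnit_iff_isUnit_det _).mp c.isUnit
  rw [← rank_mul_eq_right_of_isUnit_det _ ((A : Matrix ν ν K) - 1) hdet,
    ← rank_mul_eq_left_of_isUnit_det _ ((B : Matrix ν ν K) - 1) hdet, mul_sub, sub_mul, hc',
    mul_one, one_mul]

end BlockSum

section CubeRootBlocks

variable (K : Type*) [Field K]

/-- The matrix `T`, of order three in characteristic two. -/
def tBlock : Matrix (Fin 2) (Fin 2) K := !![1, 1; 1, 0]

variable [CharP K 2]

theorem tBlock_sq : tBlock K ^ 2 = !![0, 1; 1, 1] := by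
  simp [tBlock, pow_two, CharTwo.add_self_eq_zero]

theorem tBlock_pow_three : tBlock K ^ 3 = 1 := by
  rw [pow_succ, tBlock_sq]
  simp [tBlock, one_fin_two, CharTwo.add_self_eq_zero]

theorem tBlock_pow_mod (m : ℕ) : tBlock K ^ m = tBlock K ^ (m % 3) := by
  conv_lhs => rw [← Nat.div_add_mod m 3, pow_add, pow_mul, tBlock_pow_three, one_pow, one_mul]

theorem tBlock_pow_submatrix_swap (m : ℕ) :
    (tBlock K ^ m).submatrix (Equiv.swap 0 1) (Equiv.swap 0 1) = tBlock K ^ (2 * m) := by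
  have h : (tBlock K).submatrix (Equiv.swap 0 1) (Equiv.swap 0 1) = tBlock K ^ 2 := by
    rw [tBlock_sq]
    ext i j
    fin_cases i <;> fin_cases j <;> simp [tBlock]
  have := map_pow (reindexAlgEquiv K K (Equiv.swap (0 : Fin 2) 1)) (tBlock K) m
  simp only [coe_reindexAlgEquiv, reindex_apply, Equiv.symm_swap] at this
  rw [this, h, pow_mul]

theorem tBlock_pow_sub_one (m : ℕ) :
    tBlock K ^ m - 1 = tBlock K ^ (2 * m) * diagonal fun _ => if 3 ∣ m then 0 else 1 := by
  have h2 : (-1 : K) = 1 := by rw [CharTwo.neg_eq]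
  have hm : m % 3 = 0 ∨ m % 3 = 1 ∨ m % 3 = 2 := by omega
  rw [pow_mul, pow_right_comm, tBlock_pow_mod]
  simp only [Nat.dvd_iff_mod_eq_zero]
  rcases hm with h | h | h
  · simp [h]
  · rw [h, pow_one, tBlock_sq]
    simp [tBlock, one_fin_two, h2]
  · rw [h, ← pow_mul, pow_succ (tBlock K) 3, tBlock_pow_three, tBlock_sq]
    ext i j
    fin_cases i <;> fin_cases j <;> simp [tBlock, h2]

variable {ι ρ ν : Type*} [Fintype ι] [DecidableEq ι] [Fintype ρ] [DecidableEq ρ]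
  [Fintype ν] [DecidableEq ν] (e : (Fin 2 × ι) ⊕ ρ ≃ ν)

/-- The invertible matrix with diagonal blocks `T ^ a i` and an identity block. -/
def tBlockSum (a : ι → ℕ) : GL ν K where
  val := blockSumHom e fun i => tBlock K ^ a i
  inv := blockSumHom e fun i => tBlock K ^ (2 * a i)
  val_inv := by
    rw [← map_mul, ← map_one (blockSumHom e)]
    congr 1
    ext1 i
    simp only [Pi.mul_apply, Pi.one_apply]
    rw [← pow_add, show a i + 2 * a i = 3 * a i by ring, pow_mul, tBlock_pow_three, one_pow]
  inv_val := by
    rw [← map_mul, ← map_one (blockSumHom e)]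
    congr 1
    ext1 i
    simp only [Pi.mul_apply, Pi.one_apply]
    rw [← pow_add, show 2 * a i + a i = 3 * a i by ring, pow_mul, tBlock_pow_three, one_pow]

theorem tBlockSum_mul (a b : ι → ℕ) :
    tBlockSum K e a * tBlockSum K e b = tBlockSum K e (a + b) := by
  refine Units.ext ?_
  simp only [tBlockSum, Units.val_mul, ← map_mul]
  congr 1
  ext1 i
  simp [pow_add]

theorem tBlockSum_commute (a b : ι → ℕ) :
    tBlockSum K e a * tBlockSum K e b = tBlockSum K e b * tBlockSum K e a := by
  rw [tBlockSum_mul, tBlockSum_mul, add_comm]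

theorem isConj_tBlockSum_comp (a : ι → ℕ) (σ : Equiv.Perm ι) :
    IsConj (tBlockSum K e a) (tBlockSum K e (a ∘ σ)) := by
  refine isConj_of_coe_eq_submatrix (blockPerm e σ (Equiv.refl _)) ?_
  refine ((reindex_blockSum_submatrix e σ _ _).trans ?_).symm
  simp [tBlockSum, blockSumHom]

theorem isConj_tBlockSum_two_mul (a : ι → ℕ) :
    IsConj (tBlockSum K e a) (tBlockSum K e fun i => 2 * a i) := by
  refine isConj_of_coe_eq_submatrix (blockPerm e (Equiv.refl _) (Equiv.swap 0 1)) ?_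
  refine ((reindex_blockSum_submatrix e _ _ _).trans ?_).symm
  simp [tBlockSum, blockSumHom, tBlock_pow_submatrix_swap]

theorem rank_tBlockSum_sub_one (a : ι → ℕ) :
    ((tBlockSum K e a : Matrix ν ν K) - 1).rank = 2 * Fintype.card {i // ¬ 3 ∣ a i} := by
  classical
  have h : (tBlockSum K e a : Matrix ν ν K) - 1 =
      (tBlockSum K e fun i => 2 * a i : Matrix ν ν K) * reindex e e (diagonal
        (Sum.elim (fun p : Fin 2 × ι => if 3 ∣ a p.2 then (0 : K) else 1) 0)) := by
    have hd := fromBlocks_diagonal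
      (fun p : Fin 2 × ι => if 3 ∣ a p.2 then (0 : K) else 1) (0 : ρ → K)
    have hb := blockDiagonal_diagonal
      (fun (i : ι) (_ : Fin 2) => if 3 ∣ a i then (0 : K) else 1)
    rw [← hd, ← hb, ← map_one (blockSumHom e)]
    simp only [tBlockSum, blockSumHom, MonoidHom.coe_mk, OneHom.coe_mk, reindex_apply,
      submatrix_mul_equiv, fromBlocks_multiply, ← blockDiagonal_mul, ← tBlock_pow_sub_one]
    ext p q
    obtain ⟨p, rfl⟩ := e.surjective p
    obtain ⟨q, rfl⟩ := e.surjective q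
    rcases p with ⟨x, i⟩ | p <;> rcases q with ⟨y, j⟩ | q <;>
      simp [blockDiagonal_apply, one_apply]
    grind
  rw [h, rank_mul_eq_right_of_isUnit_det _ _
    ((isUnit_iff_isUnit_det _).mp (tBlockSum K e _).isUnit), rank_reindex, rank_diagonal,
    Fintype.card_subtype, Fintype.card_subtype, Finset.card_filter, Finset.card_filter,
    Fintype.sum_sum_type, Fintype.sum_prod_type]
  simp

theorem Dmat_eq_tBlockSum {m k r n : ℕ} (e : (Fin 2 × Fin m) ⊕ Fin r ≃ Fin n)
    (he : ∀ x i, (e (.inl (x, i)) : ℕ) = x + 2 * i) (he' : ∀ q, (e (.inr q) : ℕ) = m * 2 + q)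
    (hkm : k ≤ m) :
    Dmat K n k = tBlockSum K e fun i => if (i : ℕ) < k then 1 else 0 := by
  ext p q
  obtain ⟨p, rfl⟩ := e.surjective p
  obtain ⟨q, rfl⟩ := e.surjective q
  rcases p with ⟨x, i⟩ | p <;> rcases q with ⟨y, j⟩ | q <;>
    simp only [Dmat, of_apply, he, he', EmbeddingLike.apply_eq_iff_eq, tBlockSum, blockSumHom,
      MonoidHom.coe_mk, OneHom.coe_mk, reindex_apply, submatrix_apply, Equiv.symm_apply_apply,
      fromBlocks_apply₁₁, fromBlocks_apply₁₂, fromBlocks_apply₂₁, fromBlocks_apply₂₂,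
      blockDiagonal_apply, one_apply, Matrix.zero_apply]
  · have hx (z : Fin 2) (l : Fin m) : (z + 2 * l : ℕ) < 2 * k ↔ (l : ℕ) < k := by omega
    have hdiv (z : Fin 2) (l : Fin m) : (z + 2 * l : ℕ) / 2 = l := by omega
    have hmod (z : Fin 2) (l : Fin m) : (z + 2 * l : ℕ) % 2 = z := by omega
    simp only [hx, hdiv, hmod, Sum.inl.injEq, Prod.mk.injEq, ← Fin.ext_iff]
    rcases eq_or_ne i j with rfl | hij
    · by_cases hi : (i : ℕ) < k
      · fin_cases x <;> fin_cases y <;> simp [hi, tBlock]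
      · simp [hi, one_apply]
    · simp [hij]
  all_goals
    rw [if_neg (by omega)]
    simp

end CubeRootBlocks

theorem four_nonconjugate_products_of_conjugates_of_Dk
    (K : Type*) [Field K] [CharP K 2]
    (hcube : ∀ x : K, x ^ 3 = 1 → x = 1)
    (n k : ℕ) (hk : 2 ≤ k) (hn : 4 * k ≤ n)
    (D : Matrix.GeneralLinearGroup (Fin n) K)
    (hD : (D : Matrix (Fin n) (Fin n) K) = Dmat K n k) :
    ∃ A₁ B₁ A₂ B₂ A₃ B₃ A₄ B₄ : Matrix.GeneralLinearGroup (Fin n) K,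
      IsConj D A₁ ∧ IsConj D B₁ ∧ A₁ * B₁ = B₁ * A₁ ∧
      IsConj D A₂ ∧ IsConj D B₂ ∧ A₂ * B₂ = B₂ * A₂ ∧
      IsConj D A₃ ∧ IsConj D B₃ ∧ A₃ * B₃ = B₃ * A₃ ∧
      IsConj D A₄ ∧ IsConj D B₄ ∧ A₄ * B₄ = B₄ * A₄ ∧
      ¬ IsConj (A₁ * B₁) (A₂ * B₂) ∧ ¬ IsConj (A₁ * B₁) (A₃ * B₃) ∧
      ¬ IsConj (A₁ * B₁) (A₄ * B₄) ∧ ¬ IsConj (A₂ * B₂) (A₃ * B₃) ∧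
      ¬ IsConj (A₂ * B₂) (A₄ * B₄) ∧ ¬ IsConj (A₃ * B₃) (A₄ * B₄) := by
  obtain ⟨r, rfl⟩ : ∃ r, n = 2 * k * 2 + r := ⟨n - 4 * k, by omega⟩
  obtain ⟨e, he, he'⟩ : ∃ e : (Fin 2 × Fin (2 * k)) ⊕ Fin r ≃ Fin (2 * k * 2 + r),
      (∀ x i, (e (.inl (x, i)) : ℕ) = x + 2 * i) ∧ ∀ q, (e (.inr q) : ℕ) = 2 * k * 2 + q :=
    ⟨(((Equiv.prodComm _ _).trans finProdFinEquiv).sumCongr (Equiv.refl _)).trans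
      finSumFinEquiv, fun _ _ => rfl, fun _ => rfl⟩
  let a : Fin (2 * k) → ℕ := fun i => if (i : ℕ) < k then 1 else 0
  obtain rfl : D = tBlockSum K e a := Units.ext (hD.trans (Dmat_eq_tBlockSum K e he he' (by omega)))
  let σ : Equiv.Perm (Fin (2 * k)) := Equiv.swap ⟨0, by omega⟩ ⟨k, by omega⟩
  have card_eq (f : Fin (2 * k) → ℕ) (l : ℕ) (hl : l ≤ 2 * k)
      (hf : ∀ i, ¬ 3 ∣ f i ↔ (i : ℕ) < l) : Fintype.card {i // ¬ 3 ∣ f i} = l := by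
    simp [Fintype.card_subtype, hf, Fin.card_filter_val_lt, hl]
  have h₁ : Fintype.card {i // ¬ 3 ∣ (a + fun i => 2 * a i) i} = 0 := by
    refine card_eq _ _ (by omega) fun i => ?_
    simp only [Pi.add_apply]
    omega
  have h₂ : Fintype.card {i // ¬ 3 ∣ (a + a) i} = k := by
    refine card_eq _ _ (by omega) fun i => ?_
    simp only [Pi.add_apply, a]
    split_ifs <;> omega
  have h₃ : Fintype.card {i // ¬ 3 ∣ (a + a ∘ σ) i} = k + 1 := by
    refine card_eq _ _ (by omega) fun i => ?_
    simp only [Pi.add_apply, Function.comp_apply, a, σ, Equiv.swap_apply_def, Fin.ext_iff]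
    grind
  have h₄ : Fintype.card {i // ¬ 3 ∣ (a + a ∘ Fin.revPerm) i} = 2 * k := by
    refine card_eq _ _ le_rfl fun i => ?_
    simp only [Pi.add_apply, Function.comp_apply, a, Fin.revPerm_apply, Fin.val_rev]
    split_ifs <;> omega
  have key : ∀ b c : Fin (2 * k) → ℕ,
      Fintype.card {i // ¬ 3 ∣ b i} ≠ Fintype.card {i // ¬ 3 ∣ c i} →
      ¬ IsConj (tBlockSum K e b) (tBlockSum K e c) := by
    intro b c hbc h
    have := rank_sub_one_eq_of_isConj h
    rw [rank_tBlockSum_sub_one, rank_tBlockSum_sub_one] at this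
    omega
  refine ⟨tBlockSum K e a, tBlockSum K e fun i => 2 * a i, tBlockSum K e a, tBlockSum K e a,
    tBlockSum K e a, tBlockSum K e (a ∘ σ), tBlockSum K e a, tBlockSum K e (a ∘ Fin.revPerm),
    .refl _, isConj_tBlockSum_two_mul K e a, tBlockSum_commute K e _ _,
    .refl _, .refl _, rfl,
    .refl _, isConj_tBlockSum_comp K e a _, tBlockSum_commute K e _ _,
    .refl _, isConj_tBlockSum_comp K e a _, tBlockSum_commute K e _ _, ?_⟩
  simp only [tBlockSum_mul]
  refine ⟨?_, ?_, ?_, ?_, ?_, ?_⟩ <;> apply key <;> omega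
end

section
/- Let K be a field of characteristic 2 in which 1 is the only cube root of unity, and let a, b ∈ K. If the 2×2 matrix M with rows (a, b) and (b, a+b) satisfies M³ = I₂, then M = I₂, or M = T, or M = T². -/
theorem cube_root_block_is_one_T_or_Tsq
    (K : Type*) [Field K] [CharP K 2]
    (hcube : ∀ x : K, x ^ 3 = 1 → x = 1)
    (a b : K) (h : (!![a, b; b, a + b]) ^ 3 = 1) :
    !![a, b; b, a + b] = 1 ∨
    !![a, b; b, a + b] = !![(1 : K), 1; 1, 0] ∨
    !![a, b; b, a + b] = !![(1 : K), 1; 1, 0] ^ 2 := by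
  have two_eq_zero : (2 : K) = 0 := CharTwo.two_eq_zero
  have h_diag := congrFun (congrFun h 0) 0
  have h_off := congrFun (congrFun h 0) 1
  simp [pow_succ, Matrix.mul_apply, Fin.sum_univ_two] at h_diag h_off
  have h_prod : a * b * (a + b) = 0 := by
    linear_combination h_off - (a ^ 2 * b + a * b ^ 2 + b ^ 3) * two_eq_zero
  rcases mul_eq_zero.mp h_prod with hab | hab
  · rcases mul_eq_zero.mp hab with rfl | rfl
    · obtain rfl : b = 1 := hcube b (by linear_combination h_diag)
      right; right
      ext i j
      fin_cases i <;> fin_cases j <;>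
        simp [pow_two, Matrix.mul_apply, Fin.sum_univ_two, CharTwo.add_self_eq_zero]
    · obtain rfl : a = 1 := hcube a (by linear_combination h_diag)
      left
      simp [Matrix.one_fin_two]
  · obtain rfl : a = b := CharTwo.add_eq_zero.mp hab
    obtain rfl : a = 1 := hcube a (by linear_combination h_diag - 2 * a ^ 3 * two_eq_zero)
    right; left
    simp [CharTwo.add_self_eq_zero]
end

section
/- Let K be a field of characteristic 2 in which 1 is the only cube root of unity, let n ≥ 2, and let G₁ ∈ M_n(K) be the block-diagonal matrix diag(T, I_{n−2}). If C ∈ M_n(K) satisfies C³ = 1 and C commutes with G₁, then C is block-diagonal of the form C = diag(B, C′) where B ∈ M₂(K) is one of I₂, T, T², and C′ ∈ M_{n−2}(K) satisfies C′³ = 1. -/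
/-- The block-diagonal `n × n` matrix `G₁ = diag(T, I_{n-2})`, where `T = !![1,1;1,0]`. -/
def G1mat (K : Type*) [Field K] (n : ℕ) : Matrix (Fin n) (Fin n) K :=
  Matrix.of fun p q =>
    if (p : ℕ) < 2 ∧ (q : ℕ) < 2 then
      (if (p : ℕ) = 1 ∧ (q : ℕ) = 1 then 0 else 1)
    else (if p = q then 1 else 0)

/-- In characteristic 2, a `2 × 2` cube root of unity commuting with `T = !![1, 1; 1, 0]` is a power
of `T`, provided that `1` is the only cube root of unity in the field. -/
theorem cube_root_commuting_with_fin_two {K : Type*} [Field K] [CharP K 2]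
    (hcube : ∀ x : K, x ^ 3 = 1 → x = 1) {A : Matrix (Fin 2) (Fin 2) K} (hA : A ^ 3 = 1)
    (hcomm : A * !![(1 : K), 1; 1, 0] = !![(1 : K), 1; 1, 0] * A) :
    A = 1 ∨ A = !![(1 : K), 1; 1, 0] ∨ A = !![(1 : K), 1; 1, 0] ^ 2 := by
  have h2 : (2 : K) = 0 := CharTwo.two_eq_zero
  have h00 := congrFun₂ hcomm 0 0
  have h01 := congrFun₂ hcomm 0 1
  simp [Matrix.mul_apply, Fin.sum_univ_two] at h00 h01
  obtain ⟨x, hx⟩ : ∃ x, A 1 1 = x := ⟨_, rfl⟩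
  obtain ⟨y, hy⟩ : ∃ y, A 0 1 = y := ⟨_, rfl⟩
  have hA' : A = !![x + y, y; y, x] := by
    rw [Matrix.eta_fin_two A]
    congr <;> grind
  subst hA'
  have e01 := congrFun₂ hA 0 1
  have e11 := congrFun₂ hA 1 1
  simp [pow_succ, Matrix.mul_apply, Fin.sum_univ_two] at e01 e11
  have hxy : x * y * (x + y) = 0 := by grind
  rcases mul_eq_zero.1 hxy with h | h
  · rcases mul_eq_zero.1 h with rfl | rfl
    · obtain rfl : y = 1 := hcube y (by grind)
      right; left; simp
    · obtain rfl : x = 1 := hcube x (by grind)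
      left; simp [Matrix.one_fin_two]
  · obtain rfl : x = y := by grind
    obtain rfl : x = 1 := hcube x (by grind)
    right; right
    ext i j
    fin_cases i <;> fin_cases j <;> simp [pow_two]

/-- `G₁` is the reindexed block-diagonal matrix with blocks `T` and `1`. -/
theorem G1mat_eq_reindex (K : Type*) [Field K] (n : ℕ) (h : 2 + (n - 2) = n) :
    G1mat K n = Matrix.reindex (finSumFinEquiv.trans (finCongr h))
      (finSumFinEquiv.trans (finCongr h)) (Matrix.fromBlocks !![(1 : K), 1; 1, 0] 0 0 1) := by
  rw [← Equiv.symm_apply_eq]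
  ext (i | i) (j | j)
  · fin_cases i <;> fin_cases j <;> simp [G1mat]
  · have : (i : ℕ) ≠ 2 + j := by omega
    simp [G1mat, Fin.ext_iff, this]
    omega
  · have : 2 + (i : ℕ) ≠ j := by omega
    simp [G1mat, Fin.ext_iff, this]
    omega
  · simp [G1mat, Fin.ext_iff, Matrix.one_apply]
    omega

theorem cube_root_commuting_with_G1_is_block_diagonal
    (K : Type*) [Field K] [CharP K 2]
    (hcube : ∀ x : K, x ^ 3 = 1 → x = 1)
    (n : ℕ) (hn : 2 ≤ n)
    (C : Matrix (Fin n) (Fin n) K)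
    (hC3 : C ^ 3 = 1)
    (hcomm : C * G1mat K n = G1mat K n * C) :
    ∃ (B : Matrix (Fin 2) (Fin 2) K) (C' : Matrix (Fin (n - 2)) (Fin (n - 2)) K),
      (B = 1 ∨ B = !![(1 : K), 1; 1, 0] ∨ B = !![(1 : K), 1; 1, 0] ^ 2) ∧
      C' ^ 3 = 1 ∧
      C = Matrix.reindex (finSumFinEquiv.trans (finCongr (by omega)))
            (finSumFinEquiv.trans (finCongr (by omega)))
            (Matrix.fromBlocks B 0 0 C') := by
  have h : 2 + (n - 2) = n := by omega
  rw [G1mat_eq_reindex K n h] at hcomm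
  generalize finSumFinEquiv.trans (finCongr h) = e at hcomm ⊢
  obtain ⟨D, rfl⟩ := (Matrix.reindex e e).surjective C
  obtain ⟨A, b, c, d, rfl⟩ : ∃ A b c d, D = Matrix.fromBlocks A b c d :=
    ⟨_, _, _, _, (Matrix.fromBlocks_toBlocks D).symm⟩
  rw [← Matrix.coe_reindexAlgEquiv K K, ← map_mul,
    ← map_mul, (Matrix.reindexAlgEquiv K K e).injective.eq_iff, Matrix.fromBlocks_multiply,
    Matrix.fromBlocks_multiply, Matrix.fromBlocks_inj] at hcomm
  rw [← Matrix.coe_reindexAlgEquiv K K, ← map_pow, map_eq_one_iff _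
    (Matrix.reindexAlgEquiv K K e).injective] at hC3
  obtain ⟨hA, hb, hc, -⟩ := hcomm
  simp only [Matrix.mul_zero, Matrix.zero_mul, add_zero, zero_add, Matrix.mul_one,
    Matrix.one_mul] at hA hb hc
  obtain rfl : b = 0 := by
    ext i j
    have h0 := congrFun₂ hb 0 j
    have h1 := congrFun₂ hb 1 j
    simp [Matrix.mul_apply, Fin.sum_univ_two] at h0 h1
    fin_cases i <;> simp [h0, ← h1]
  obtain rfl : c = 0 := by
    ext i j
    have h0 := congrFun₂ hc i 0
    have h1 := congrFun₂ hc i 1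
    simp [Matrix.mul_apply, Fin.sum_univ_two] at h0 h1
    fin_cases j <;> simp [h0, h1]
  rw [Matrix.fromBlocks_diagonal_pow, ← Matrix.fromBlocks_one, Matrix.fromBlocks_inj] at hC3
  exact ⟨A, d, cube_root_commuting_with_fin_two hcube hC3.1 hA, hC3.2.2.2, rfl⟩
end

section
/- Let K be a field of characteristic 2 and let n ≥ 5. If M ∈ M_n(K) commutes with G_k for every k with 3 ≤ k ≤ n−1, then there exist a matrix M₀ ∈ M₂(K) and a scalar a ∈ K such that M is the block-diagonal matrix diag(M₀, a·I_{n−2}). -/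
/-- The `n × n` matrix `G_k` that agrees with the identity except that its `2×2`
block in rows and columns `k`, `k+1` (0-indexed) equals `T = !![1,1;1,0]`.
The matrix `G_k` of the paper, whose `T`-block sits in rows and columns `k`, `k+1`
in 1-indexed notation, is `Gmat K n (k - 1)` in this 0-indexed notation. -/
def Gmat (K : Type*) [Field K] (n k : ℕ) : Matrix (Fin n) (Fin n) K :=
  Matrix.of fun p q =>
    if (p : ℕ) = k ∧ (q : ℕ) = k then 1
    else if (p : ℕ) = k ∧ (q : ℕ) = k + 1 then 1
    else if (p : ℕ) = k + 1 ∧ (q : ℕ) = k then 1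
    else if (p : ℕ) = k + 1 ∧ (q : ℕ) = k + 1 then 0
    else if p = q then 1 else 0

/-- `G_j` is a perturbation of the identity supported on the block `{j, j + 1}`. -/
lemma Gmat_eq_one_add_single (K : Type*) [Field K] {n : ℕ} (i j : Fin n)
    (hij : (j : ℕ) = i + 1) :
    Gmat K n i = 1 + (Matrix.single i j 1 + Matrix.single j i 1 - Matrix.single j j 1) := by
  ext p q
  simp only [Gmat, Matrix.of_apply, Matrix.add_apply, Matrix.sub_apply, Matrix.one_apply,
    Matrix.single_apply, Fin.ext_iff, hij]
  split_ifs <;> first | omega | simp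

section Commute

variable {K : Type*} [Field K] {n : ℕ} {M : Matrix (Fin n) (Fin n) K} {i j : Fin n}

lemma mul_single_eq_of_commute_Gmat (hij : (j : ℕ) = i + 1)
    (h : M * Gmat K n i = Gmat K n i * M) :
    M * (Matrix.single i j 1 + Matrix.single j i 1 - Matrix.single j j 1) =
      (Matrix.single i j 1 + Matrix.single j i 1 - Matrix.single j j 1) * M := by
  rw [Gmat_eq_one_add_single K i j hij, mul_add, add_mul, mul_one, one_mul] at h
  exact add_left_cancel h

/-- If `M` commutes with `G_i`, columns `i`, `i + 1` of `M` vanish outside the block. -/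
lemma apply_eq_zero_of_commute_Gmat_col (hij : (j : ℕ) = i + 1)
    (h : M * Gmat K n i = Gmat K n i * M) {p : Fin n} (hpi : p ≠ i) (hpj : p ≠ j) :
    M p i = 0 ∧ M p j = 0 := by
  have hne : i ≠ j := by rintro rfl; omega
  have h := mul_single_eq_of_commute_Gmat hij h
  have h₁ := congrFun (congrFun h p) i
  have h₂ := congrFun (congrFun h p) j
  simp [mul_add, add_mul, mul_sub, sub_mul, hpi, hpj, hne, hne.symm] at h₁ h₂
  simp_all

/-- If `M` commutes with `G_i`, rows `i`, `i + 1` of `M` vanish outside the block. -/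
lemma apply_eq_zero_of_commute_Gmat_row (hij : (j : ℕ) = i + 1)
    (h : M * Gmat K n i = Gmat K n i * M) {q : Fin n} (hqi : q ≠ i) (hqj : q ≠ j) :
    M i q = 0 ∧ M j q = 0 := by
  have hne : i ≠ j := by rintro rfl; omega
  have h := mul_single_eq_of_commute_Gmat hij h
  have h₁ := congrFun (congrFun h i) q
  have h₂ := congrFun (congrFun h j) q
  simp [mul_add, add_mul, mul_sub, sub_mul, hqi, hqj, hne, hne.symm] at h₁ h₂
  exact ⟨by linear_combination -h₁ - h₂, h₁.symm⟩

lemma diag_eq_of_commute_Gmat (hij : (j : ℕ) = i + 1)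
    (h : M * Gmat K n i = Gmat K n i * M) (h0 : M i j = 0) : M i i = M j j := by
  have hne : i ≠ j := by rintro rfl; omega
  have h₁ := congrFun (congrFun (mul_single_eq_of_commute_Gmat hij h) i) j
  simpa [mul_add, add_mul, mul_sub, sub_mul, hne, hne.symm, h0] using h₁

end Commute

theorem commutes_with_all_Gk_is_corner_plus_scalar
    (K : Type*) [Field K] [CharP K 2]
    (n : ℕ) (hn : 5 ≤ n)
    (M : Matrix (Fin n) (Fin n) K)
    -- `M` commutes with `G_k` for every `3 ≤ k ≤ n-1` (1-indexed), i.e. with every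
    -- `Gmat K n j` for `2 ≤ j ≤ n-2` (0-indexed)
    (hcomm : ∀ j : ℕ, 2 ≤ j → j + 1 < n → M * Gmat K n j = Gmat K n j * M) :
    ∃ (M₀ : Matrix (Fin 2) (Fin 2) K) (a : K),
      M = Matrix.reindex (finSumFinEquiv.trans (finCongr (by omega)))
            (finSumFinEquiv.trans (finCongr (by omega)))
            (Matrix.fromBlocks M₀ 0 0 (a • (1 : Matrix (Fin (n - 2)) (Fin (n - 2)) K))) := by
  have hcol (i : ℕ) (hi : 2 ≤ i) (hi' : i + 1 < n) (p : Fin n) (h₁ : (p : ℕ) ≠ i)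
      (h₂ : (p : ℕ) ≠ i + 1) : M p ⟨i, by omega⟩ = 0 ∧ M p ⟨i + 1, hi'⟩ = 0 :=
    apply_eq_zero_of_commute_Gmat_col rfl (hcomm i hi hi')
      (fun h => h₁ (congrArg Fin.val h)) (fun h => h₂ (congrArg Fin.val h))
  have hrow (i : ℕ) (hi : 2 ≤ i) (hi' : i + 1 < n) (q : Fin n) (h₁ : (q : ℕ) ≠ i)
      (h₂ : (q : ℕ) ≠ i + 1) : M ⟨i, by omega⟩ q = 0 ∧ M ⟨i + 1, hi'⟩ q = 0 :=
    apply_eq_zero_of_commute_Gmat_row rfl (hcomm i hi hi')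
      (fun h => h₁ (congrArg Fin.val h)) (fun h => h₂ (congrArg Fin.val h))
  have hoff (p q : ℕ) (hp : p < n) (hq : q < n) (hpq : p ≠ q) (h : 2 ≤ p ∨ 2 ≤ q) :
      M ⟨p, hp⟩ ⟨q, hq⟩ = 0 := by
    by_cases c₁ : 2 ≤ q ∧ q + 1 < n ∧ p ≠ q + 1
    · exact (hcol q c₁.1 c₁.2.1 ⟨p, hp⟩ hpq c₁.2.2).1
    by_cases c₂ : 3 ≤ q ∧ p + 1 ≠ q
    · obtain ⟨r, rfl⟩ : ∃ r, q = r + 1 := ⟨q - 1, by omega⟩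
      exact (hcol r (by omega) hq ⟨p, hp⟩ (by simp only; omega) hpq).2
    by_cases c₃ : 2 ≤ p ∧ p + 1 < n ∧ q ≠ p + 1
    · exact (hrow p c₃.1 c₃.2.1 ⟨q, hq⟩ hpq.symm c₃.2.2).1
    obtain ⟨r, rfl⟩ : ∃ r, p = r + 1 := ⟨p - 1, by omega⟩
    exact (hrow r (by omega) hp ⟨q, hq⟩ (by simp only; omega) hpq.symm).2
  have hdiag (m : ℕ) (hm : 2 + m < n) :
      M ⟨2 + m, hm⟩ ⟨2 + m, hm⟩ = M ⟨2, by omega⟩ ⟨2, by omega⟩ := by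
    induction m with
    | zero => rfl
    | succ m ih =>
      rw [← ih (by omega)]
      exact (diag_eq_of_commute_Gmat (i := ⟨2 + m, by omega⟩) (j := ⟨2 + (m + 1), hm⟩) rfl
        (hcomm (2 + m) (by omega) hm) (hoff _ _ _ _ (by omega) (by omega))).symm
  refine ⟨M.submatrix (Fin.castLE (by omega)) (Fin.castLE (by omega)),
    M ⟨2, by omega⟩ ⟨2, by omega⟩, ?_⟩
  rw [← Equiv.symm_apply_eq]
  ext (p | p) (q | q)
  · rfl
  · exact hoff p (2 + q) _ _ (by omega) (by omega)
  · exact hoff (2 + p) q _ _ (by omega) (by omega)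
  · by_cases hpq : p = q
    · subst hpq
      simpa using! hdiag p (by omega)
    · simpa [hpq] using! hoff (2 + p) (2 + q) (by omega) (by omega)
        (fun h => hpq (Fin.ext (by omega))) (by omega)
end

section
/- Let K be a field of characteristic 2, and for each k ≥ 3 let G_k be the element of the stable linear group GL(K) that agrees with the identity except that its 2×2 block in rows and columns k, k+1 equals T. If M ∈ GL(K) commutes with G_k for every k ≥ 3, then M lies in the image of GL₂(K) under the top-left-corner embedding; that is, M agrees with the identity outside its top-left 2×2 corner. -/
/-- The `(i, j)` matrix entry of an element of the stable linear group. -/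
noncomputable def entry {K : Type*} [Field K] (f : StableGL K) (i j : ℕ) : K :=
  ((f : (ℕ →₀ K) ≃ₗ[K] (ℕ →₀ K)) (Finsupp.single j 1)) i

section Block

variable {K : Type*} [Field K] {g : StableGL K} {k : ℕ}

/-- A linear functional on `ℕ →₀ K` is determined by its values on the standard basis. -/
theorem linearMap_apply_eq_of_single {φ ψ : (ℕ →₀ K) →ₗ[K] K}
    (h : ∀ j, φ (Finsupp.single j 1) = ψ (Finsupp.single j 1)) (v : ℕ →₀ K) : φ v = ψ v := by
  have : φ = ψ := Finsupp.lhom_ext' fun j => LinearMap.ext_ring (h j)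
  rw [this]

/-- `g` agrees with the identity except for the block `!![1, 1; 1, 0]` in rows and columns
`k - 1` and `k`. -/
def HasBlock (g : StableGL K) (k : ℕ) : Prop :=
  ∀ i j : ℕ, entry g i j =
    if i = k - 1 ∧ j = k - 1 then 1
    else if i = k - 1 ∧ j = k then 1
    else if i = k ∧ j = k - 1 then 1
    else if i = k ∧ j = k then 0
    else if i = j then 1 else 0

theorem HasBlock.apply_single (hg : HasBlock g k) (i j : ℕ) :
    g.1 (Finsupp.single j 1) i =
      if i = k - 1 ∧ j = k - 1 then 1
      else if i = k - 1 ∧ j = k then 1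
      else if i = k ∧ j = k - 1 then 1
      else if i = k ∧ j = k then 0
      else if i = j then 1 else 0 :=
  hg i j

theorem HasBlock.single_pred (hg : HasBlock g k) (hk : 3 ≤ k) :
    g.1 (Finsupp.single (k - 1) 1) = Finsupp.single (k - 1) 1 + Finsupp.single k 1 := by
  ext l
  rw [hg.apply_single, Finsupp.add_apply, Finsupp.single_apply, Finsupp.single_apply]
  grind

theorem HasBlock.single_self (hg : HasBlock g k) (hk : 3 ≤ k) :
    g.1 (Finsupp.single k 1) = Finsupp.single (k - 1) 1 := by
  ext l
  rw [hg.apply_single, Finsupp.single_apply]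
  grind

theorem HasBlock.single_of_ne (hg : HasBlock g k) {j : ℕ} (hj : j ≠ k - 1) (hj' : j ≠ k) :
    g.1 (Finsupp.single j 1) = Finsupp.single j 1 := by
  ext l
  rw [hg.apply_single, Finsupp.single_apply]
  grind

theorem HasBlock.apply_pred (hg : HasBlock g k) (hk : 3 ≤ k) (v : ℕ →₀ K) :
    g.1 v (k - 1) = v (k - 1) + v k := by
  refine linearMap_apply_eq_of_single
    (φ := Finsupp.lapply (k - 1) ∘ₗ g.1.toLinearMap)
    (ψ := Finsupp.lapply (k - 1) + Finsupp.lapply k) (fun j => ?_) v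
  simp only [LinearMap.comp_apply, LinearMap.add_apply, Finsupp.lapply_apply,
    LinearEquiv.coe_coe, hg.apply_single, Finsupp.single_apply]
  grind

theorem HasBlock.apply_self (hg : HasBlock g k) (hk : 3 ≤ k) (v : ℕ →₀ K) :
    g.1 v k = v (k - 1) := by
  refine linearMap_apply_eq_of_single
    (φ := Finsupp.lapply k ∘ₗ g.1.toLinearMap) (ψ := Finsupp.lapply (k - 1)) (fun j => ?_) v
  simp only [LinearMap.comp_apply, Finsupp.lapply_apply,
    LinearEquiv.coe_coe, hg.apply_single, Finsupp.single_apply]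
  grind

theorem HasBlock.apply_of_ne (hg : HasBlock g k) {i : ℕ} (hi : i ≠ k - 1) (hi' : i ≠ k)
    (v : ℕ →₀ K) : g.1 v i = v i := by
  refine linearMap_apply_eq_of_single
    (φ := Finsupp.lapply i ∘ₗ g.1.toLinearMap) (ψ := Finsupp.lapply i) (fun j => ?_) v
  have := hg i j
  simp only [hi, hi', false_and, if_false] at this
  simpa [entry, Finsupp.single_apply, eq_comm] using this

end Block

theorem commutes_with_all_stable_Gk_lies_in_GL2
    (K : Type*) [Field K] [CharP K 2]
    (G : ℕ → StableGL K)
    -- for `k ≥ 3`, `G k` agrees with the identity except that its `2×2` block in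
    -- rows and columns `k`, `k+1` (1-indexed; i.e. `k-1`, `k` in 0-indexed
    -- notation) equals `T = !![1,1;1,0]`
    (hG : ∀ k : ℕ, 3 ≤ k → ∀ i j : ℕ,
      entry (G k) i j =
        if i = k - 1 ∧ j = k - 1 then 1
        else if i = k - 1 ∧ j = k then 1
        else if i = k ∧ j = k - 1 then 1
        else if i = k ∧ j = k then 0
        else if i = j then 1 else 0)
    (M : StableGL K)
    (hM : ∀ k : ℕ, 3 ≤ k → M * G k = G k * M) :
    -- `M` agrees with the identity outside its top-left `2×2` corner, i.e. it lies
    -- in the image of `GL₂(K)` under the top-left-corner embedding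
    ∀ i j : ℕ, ¬(i < 2 ∧ j < 2) → entry M i j = if i = j then 1 else 0 := by
  have block : ∀ k, 3 ≤ k → HasBlock (G k) k := hG
  have commutes : ∀ k, 3 ≤ k → ∀ v : ℕ →₀ K, M.1 ((G k).1 v) = (G k).1 (M.1 v) := by
    intro k hk v
    exact congrArg (fun f : StableGL K => f.1 v) (hM k hk)
  have col_pred : ∀ k, 3 ≤ k → ∀ i,
      entry M i (k - 1) + entry M i k = (G k).1 (M.1 (Finsupp.single (k - 1) 1)) i := by
    intro k hk i
    rw [← commutes k hk, (block k hk).single_pred hk, map_add]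
    rfl
  have col_self : ∀ k, 3 ≤ k → ∀ i,
      entry M i (k - 1) = (G k).1 (M.1 (Finsupp.single k 1)) i := by
    intro k hk i
    rw [← commutes k hk, (block k hk).single_self hk]
    rfl
  have col_of_ne : ∀ k, 3 ≤ k → ∀ j, j ≠ k - 1 → j ≠ k → ∀ i,
      entry M i j = (G k).1 (M.1 (Finsupp.single j 1)) i := by
    intro k hk j hj hj' i
    rw [← commutes k hk, (block k hk).single_of_ne hj hj']
    rfl
  have col_zero : ∀ k, 3 ≤ k → ∀ i, i ≠ k - 1 → i ≠ k →
      entry M i (k - 1) = 0 ∧ entry M i k = 0 := by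
    intro k hk i hi hi'
    have h1 := col_pred k hk i
    have h2 := col_self k hk i
    rw [(block k hk).apply_of_ne hi hi'] at h1 h2
    have h3 : entry M i k = 0 := add_eq_left.mp h1
    exact ⟨h2.trans h3, h3⟩
  have row_zero : ∀ k, 3 ≤ k → ∀ j, j ≠ k - 1 → j ≠ k →
      entry M (k - 1) j = 0 ∧ entry M k j = 0 := by
    intro k hk j hj hj'
    have h1 := col_of_ne k hk j hj hj' (k - 1)
    have h2 := col_of_ne k hk j hj hj' k
    rw [(block k hk).apply_pred hk] at h1
    rw [(block k hk).apply_self hk] at h2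
    have h3 : entry M k j = 0 := left_eq_add.mp h1
    exact ⟨h2.symm.trans h3, h3⟩
  have off_diag : ∀ i j, ¬(i < 2 ∧ j < 2) → i ≠ j → entry M i j = 0 := by
    intro i j hij hne
    by_cases hj : 2 ≤ j
    · by_cases hs : i = j + 1
      · exact (row_zero (i + 1) (by omega) j (by omega) (by omega)).1
      · exact (col_zero (j + 1) (by omega) i (by omega) hs).1
    · exact (row_zero (i + 1) (by omega) j (by omega) (by omega)).1
  have diag_succ : ∀ j, 2 ≤ j → entry M (j + 1) (j + 1) = entry M j j := by
    intro j hj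
    have h1 := col_pred (j + 1) (by omega) (j + 1)
    rw [(block (j + 1) (by omega)).apply_self (by omega), Nat.add_sub_cancel,
      off_diag (j + 1) j (by omega) (by omega), zero_add] at h1
    exact h1
  have diag_add : ∀ j, 2 ≤ j → ∀ n, entry M (j + n) (j + n) = entry M j j := by
    intro j hj n
    induction n with
    | zero => rfl
    | succ n ih => rw [← ih]; exact diag_succ (j + n) (by omega)
  intro i j hij
  split_ifs with h
  · subst h
    have hfin : {j : ℕ | M.1 (Finsupp.single j 1) ≠ Finsupp.single j 1}.Finite := M.2
    obtain ⟨N, hN⟩ := hfin.bddAbove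
    have hfix : M.1 (Finsupp.single (i + (N + 1)) 1) = Finsupp.single (i + (N + 1)) 1 := by
      by_contra hne
      have := hN hne
      omega
    rw [← diag_add i (by omega) (N + 1), entry, hfix, Finsupp.single_eq_same]
  · exact off_diag i j hij h
end
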